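/- arXiv:1105.5945 — 4 statements merged into one kernel-verified Lean document; each statement's English description precedes it below -/
import Mathlib

section
/- Let α > 0, let S = B(0,α) be the closed ball of radius α in ℝ², and let P_X be the uniform distribution on S (normalized Lebesgue measure restricted to S). Let X₁,…,Xₙ be i.i.d. with law P_X, let {rₙ} be a sequence of positive numbers with rₙ ≤ α for all n and n·rₙ²/log n → ∞, and let Sₙ = (𝒳ₙ ⊕ rₙB) ⊖ rₙB. Then liminf_{n→∞} rₙ^{1/3}·n^{2/3}·E(μ(S △ Sₙ)) > 0. In particular the convergence rate rₙ^{-1/3} n^{-2/3} for the expected distance in measure cannot be improved in general. -/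
open MeasureTheory Metric Set Filter
open scoped RealInnerProductSpace symmDiff ENNReal Pointwise Real

noncomputable section

/-- The Euclidean plane. -/
abbrev E2 := EuclideanSpace ℝ (Fin 2)

/-- Minkowski addition `A ⊕ C = {a + c : a ∈ A, c ∈ C}`. -/
def minkSum (A C : Set E2) : Set E2 := {z | ∃ a ∈ A, ∃ c ∈ C, z = a + c}

/-- Minkowski subtraction `A ⊖ C = {x : {x} ⊕ C ⊆ A}`. -/
def minkSub (A C : Set E2) : Set E2 := {x | minkSum {x} C ⊆ A}

/-- A closed ball of radius `α` rolls freely in a set `A`. -/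
def rollsFreely (α : ℝ) (A : Set E2) : Prop :=
  ∀ a ∈ frontier A, ∃ x, a ∈ closedBall x α ∧ closedBall x α ⊆ A

/-- The `r`-convex hull estimator `Sₙ = (𝒳ₙ ⊕ rB) ⊖ rB` of a sample `X`. -/
def estimator (r : ℝ) {n : ℕ} (X : Fin n → E2) : Set E2 :=
  minkSub (minkSum (Set.range X) (r • closedBall (0 : E2) 1)) (r • closedBall (0 : E2) 1)

/-- Area bound for the lens. -/
lemma lens_volume (α d r : ℝ) (hα : 0 < α) (hr : 0 < r) (x : E2) (hx0 : 0 < ‖x‖)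
    (hx1 : α - d < ‖x‖) (hd : 0 ≤ d) :
    volume (closedBall (x + r • (‖x‖⁻¹ • x)) r ∩ closedBall (0 : E2) α)
      ≤ ENNReal.ofReal (d * (2 * √(2 * r * d))) := by
  set u : E2 := ‖x‖⁻¹ • x with hu
  have hun : ‖u‖ = 1 := by
    rw [hu, norm_smul, norm_inv, norm_norm, inv_mul_cancel₀ hx0.ne']
  have hxu : x = ‖x‖ • u := by
    rw [hu, smul_smul, mul_inv_cancel₀ hx0.ne', one_smul]
  obtain ⟨b, hb⟩ := Orthonormal.exists_orthonormalBasis_extension_of_card_eq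
    (𝕜 := ℝ) (E := E2) (ι := Fin 2) (by simp) (v := fun _ => u) (s := {0})
    (by
      constructor
      · intro i; simpa using hun
      · intro i j hij
        exact absurd (Subsingleton.elim i j) hij)
  have hb0 : b 0 = u := hb 0 rfl
  set ρ := ‖x‖ with hρ
  set w := √(2 * r * d) with hw
  have hmp : MeasurePreserving (fun z : E2 => WithLp.ofLp (b.repr z)) volume volume :=
    (PiLp.volume_preserving_ofLp (Fin 2)).comp b.measurePreserving_repr
  have hsub : closedBall (x + r • u) r ∩ closedBall (0 : E2) α ⊆
      (fun z : E2 => WithLp.ofLp (b.repr z)) ⁻¹' Icc ![α - d, -w] ![α, w] := by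
    rintro z ⟨hz1, hz2⟩
    have hy : b.repr (x + r • u) = (ρ + r) • EuclideanSpace.single 0 1 := by
      have : x + r • u = (ρ + r) • b 0 := by rw [hb0, add_smul, ← hxu]
      rw [this, map_smul, b.repr_self]
    have e1 : ‖b.repr z‖ ≤ α := by
      rw [LinearIsometryEquiv.norm_map]; simpa using hz2
    have e2 : ‖b.repr z - b.repr (x + r • u)‖ ≤ r := by
      rw [← map_sub, LinearIsometryEquiv.norm_map, ← dist_eq_norm]; exact hz1
    rw [hy] at e2
    have e1' : ‖b.repr z‖ ^ 2 ≤ α ^ 2 := by gcongr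
    have e2' := pow_le_pow_left₀ (norm_nonneg _) e2 2
    rw [EuclideanSpace.norm_sq_eq, Fin.sum_univ_two] at e1' e2'
    change WithLp.ofLp (b.repr z) ∈ Icc ![α - d, -w] ![α, w]
    generalize b.repr z = p at *
    simp only [PiLp.sub_apply, PiLp.smul_apply, Real.norm_eq_abs, sq_abs, PiLp.single_apply] at e1' e2'
    simp at e2'
    have f1 : p 0 ≤ α := by nlinarith [sq_nonneg (p 1)]
    have f2 : ρ ≤ p 0 := by nlinarith [sq_nonneg (p 1)]
    have f3 : |p 1| ≤ w := by
      apply Real.abs_le_sqrt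
      nlinarith
    have f4 := abs_le.1 f3
    constructor
    · intro i
      fin_cases i
      · simp; linarith
      · simp; linarith
    · intro i
      fin_cases i
      · simp; linarith
      · simp; linarith
  refine (measure_mono hsub).trans ?_
  rw [hmp.measure_preimage measurableSet_Icc.nullMeasurableSet, Real.volume_Icc_pi,
    Fin.prod_univ_two, ← ENNReal.ofReal_mul (by simpa using hd)]
  apply ENNReal.ofReal_le_ofReal
  simp
  apply le_of_eq; ring

lemma not_mem_estimator (r : ℝ) (hr : 0 < r) {n : ℕ} (X : Fin n → E2) (x : E2) (hx0 : 0 < ‖x‖)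
    (h : ∀ i, X i ∉ closedBall (x + r • (‖x‖⁻¹ • x)) r) : x ∉ estimator r X := by
  intro hx
  have : x + r • (‖x‖⁻¹ • x) ∈ minkSum (Set.range X) (r • closedBall (0 : E2) 1) := by
    apply hx
    refine ⟨x, rfl, r • (‖x‖⁻¹ • x), ?_, rfl⟩
    refine ⟨‖x‖⁻¹ • x, ?_, rfl⟩
    simp [norm_smul, hx0.ne']
  obtain ⟨a, ⟨i, rfl⟩, c, ⟨c', hc', rfl⟩, heq⟩ := this
  apply h i
  rw [heq, mem_closedBall, dist_eq_norm]
  have : X i - (X i + r • c') = -(r • c') := by abel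
  simp only [this, norm_neg, norm_smul, Real.norm_eq_abs, abs_of_pos hr]
  have : ‖c'‖ ≤ 1 := by simpa using hc'
  nlinarith

lemma annulus_volume (α d : ℝ) (hd : 0 ≤ d) (hdα : d ≤ α) :
    ENNReal.ofReal (d * α * π) ≤ volume (closedBall (0 : E2) α \ closedBall (0 : E2) (α - d)) := by
  rw [measure_sdiff (closedBall_subset_closedBall (by linarith))
    measurableSet_closedBall.nullMeasurableSet measure_closedBall_lt_top.ne,
    EuclideanSpace.volume_closedBall_fin_two, EuclideanSpace.volume_closedBall_fin_two,
    ← ENNReal.ofReal_pow (by linarith), ← ENNReal.ofReal_pow (by linarith),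
    ← ENNReal.ofReal_mul (by positivity), ← ENNReal.ofReal_mul (by positivity),
    ← ENNReal.ofReal_sub _ (by positivity)]
  apply ENNReal.ofReal_le_ofReal
  have := Real.pi_pos
  have h : d * α ≤ α ^ 2 - (α - d) ^ 2 := by nlinarith
  nlinarith

lemma main_bound (α : ℝ) (hα : 0 < α) (P : Measure E2)
    (hP : P = (volume (closedBall (0 : E2) α))⁻¹ • volume.restrict (closedBall (0 : E2) α))
    (r d : ℝ) (hr : 0 < r) (hd : 0 < d) (hdα : d ≤ α) (n : ℕ) (hn : 0 < n)
    (hdn : 8 * r * d ^ 3 * (n : ℝ) ^ 2 = α ^ 4) :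
    ENNReal.ofReal (d * α * π / 2) ≤
      ∫⁻ X : Fin n → E2, volume (closedBall (0 : E2) α ∆ estimator r X)
        ∂(Measure.pi fun _ : Fin n => P) := by
  have hn' : (1 : ℝ) ≤ n := by exact_mod_cast hn
  have hv0 : volume (closedBall (0 : E2) α) ≠ 0 := (measure_closedBall_pos _ _ hα).ne'
  have hvt : volume (closedBall (0 : E2) α) ≠ ⊤ := measure_closedBall_lt_top.ne
  have : IsProbabilityMeasure P := ⟨by
    rw [hP]; simp only [Measure.smul_apply, Measure.restrict_apply_univ, smul_eq_mul]
    exact ENNReal.inv_mul_cancel hv0 hvt⟩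
  set A : Set E2 := closedBall (0 : E2) α \ closedBall (0 : E2) (α - d) with hA
  have hAm : MeasurableSet A := measurableSet_closedBall.diff measurableSet_closedBall
  set y : E2 → E2 := fun x => x + r • (‖x‖⁻¹ • x) with hy
  have hym : Measurable y := by fun_prop
  set G : Set ((Fin n → E2) × E2) := {q | q.2 ∈ A ∧ ∀ i, r < dist (q.1 i) (y q.2)} with hG
  have hGm : MeasurableSet G := by
    have hGe : G = (Prod.snd ⁻¹' A) ∩
        ⋂ i, {a : (Fin n → E2) × E2 | r < dist (a.1 i) (y a.2)} := by
      ext; simp [hG]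
    rw [hGe]
    apply MeasurableSet.inter
    · exact measurable_snd hAm
    · have := hym
      refine MeasurableSet.iInter fun i => measurableSet_lt measurable_const ?_
      exact ((measurable_pi_apply i).comp measurable_fst).dist (hym.comp measurable_snd)
  have hAx : ∀ x ∈ A, ‖x‖ ≤ α ∧ α - d < ‖x‖ ∧ 0 < ‖x‖ := by
    intro x hx
    simp only [hA, Set.mem_sdiff, mem_closedBall, dist_zero_right, not_le] at hx
    exact ⟨hx.1, hx.2, by linarith [hx.2]⟩
  have hw : d * (2 * √(2 * r * d)) = α ^ 2 / n := by
    have h1 : √(8 * r * d ^ 3) = α ^ 2 / n := by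
      rw [Real.sqrt_eq_iff_mul_self_eq (by positivity) (by positivity)]
      field_simp
      linarith
    rw [← h1]
    rw [show 8 * r * d ^ 3 = (d * 2) ^ 2 * (2 * r * d) by ring, Real.sqrt_mul (sq_nonneg (d * 2)),
      Real.sqrt_sq (by positivity)]
    ring
  have hPx : ∀ x ∈ A, P (closedBall (y x) r) ≤ ENNReal.ofReal (1 / (2 * n)) := by
    intro x hx
    obtain ⟨h1, h2, h3⟩ := hAx x hx
    have hl := lens_volume α d r hα hr x h3 h2 hd.le
    rw [hw] at hl
    rw [hP, Measure.smul_apply, Measure.restrict_apply measurableSet_closedBall, smul_eq_mul,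
      ENNReal.inv_mul_le_iff hv0 hvt]
    refine hl.trans ?_
    rw [EuclideanSpace.volume_closedBall_fin_two, ← ENNReal.ofReal_pow hα.le,
      ← ENNReal.ofReal_mul (by positivity), ← ENNReal.ofReal_mul (by positivity)]
    apply ENNReal.ofReal_le_ofReal
    rw [mul_one_div, div_le_div_iff₀ (by positivity) (by positivity)]
    have : 0 ≤ α ^ 2 * (n : ℝ) := by positivity
    nlinarith [Real.pi_gt_three]
  have hpow : ∀ x ∈ A, ENNReal.ofReal (1 / 2) ≤ P (closedBall (y x) r)ᶜ ^ n := by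
    intro x hx
    have h1 : ENNReal.ofReal (1 - 1 / (2 * n)) ≤ P (closedBall (y x) r)ᶜ := by
      rw [prob_compl_eq_one_sub measurableSet_closedBall, ENNReal.ofReal_sub _ (by positivity),
        ENNReal.ofReal_one]
      exact tsub_le_tsub_left (hPx x hx) _
    have h2 : (1 : ℝ) / (2 * n) ≤ 1 := by
      rw [div_le_one (by positivity)]; linarith
    refine le_trans ?_ (pow_le_pow_left' h1 n)
    rw [← ENNReal.ofReal_pow (by linarith)]
    apply ENNReal.ofReal_le_ofReal
    have := one_add_mul_le_pow (a := -(1 / (2 * (n : ℝ)))) (by linarith) n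
    rw [← sub_eq_add_neg] at this
    refine le_trans (le_of_eq ?_) this
    field_simp
    norm_num
  calc ENNReal.ofReal (d * α * π / 2)
      = ENNReal.ofReal (1 / 2) * ENNReal.ofReal (d * α * π) := by
        rw [← ENNReal.ofReal_mul (by norm_num)]; congr 1; ring
    _ ≤ ENNReal.ofReal (1 / 2) * volume A := by
        gcongr; exact annulus_volume α d hd.le hdα
    _ = ∫⁻ x in A, ENNReal.ofReal (1 / 2) := by simp
    _ ≤ ∫⁻ x in A, (Measure.pi fun _ : Fin n => P) ((fun X => (X, x)) ⁻¹' G) := by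
        refine setLIntegral_mono' hAm fun x hx => ?_
        have : (fun X : Fin n → E2 => (X, x)) ⁻¹' G = Set.pi univ fun _ => (closedBall (y x) r)ᶜ := by
          ext X
          simp [hG, hx]
        rw [this, Measure.pi_pi]
        simpa using hpow x hx
    _ ≤ ∫⁻ x, (Measure.pi fun _ : Fin n => P) ((fun X => (X, x)) ⁻¹' G) := setLIntegral_le_lintegral _ _
    _ = ((Measure.pi fun _ : Fin n => P).prod volume) G := (Measure.prod_apply_symm hGm).symm
    _ = ∫⁻ X, volume (Prod.mk X ⁻¹' G) ∂(Measure.pi fun _ : Fin n => P) := Measure.prod_apply hGm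
    _ ≤ _ := by
        refine lintegral_mono fun X => measure_mono ?_
        rintro x ⟨hx, hX⟩
        refine Or.inl ⟨hx.1, ?_⟩
        apply not_mem_estimator r hr X x (hAx x hx).2.2
        intro i hi
        exact absurd (hX i) (not_lt.2 hi)

theorem statement1
    (α : ℝ) (hα : 0 < α)
    (S : Set E2) (hS : S = closedBall (0 : E2) α)
    (P : Measure E2)
    (hP : P = (volume (closedBall (0 : E2) α))⁻¹ • volume.restrict (closedBall (0 : E2) α))
    (r : ℕ → ℝ) (hrpos : ∀ n, 0 < r n) (hrα : ∀ n, r n ≤ α)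
    (hlim : Tendsto (fun n : ℕ => (n : ℝ) * (r n) ^ 2 / Real.log n) atTop atTop) :
    0 < atTop.liminf (fun n : ℕ =>
      ENNReal.ofReal ((r n) ^ ((1 : ℝ) / 3) * (n : ℝ) ^ ((2 : ℝ) / 3)) *
        ∫⁻ X : Fin n → E2, volume (S ∆ estimator (r n) X) ∂(Measure.pi fun _ : Fin n => P)) := by
  subst hS
  have hc : 0 < ENNReal.ofReal ((α ^ 4 / 8) ^ ((1 : ℝ) / 3) * α * π / 2) := by
    rw [ENNReal.ofReal_pos]; positivity
  refine hc.trans_le ?_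
  refine le_liminf_of_le (by isBoundedDefault) ?_
  have hlog : ∀ᶠ n : ℕ in atTop, (1 : ℝ) ≤ Real.log n :=
    (Real.tendsto_log_atTop.comp tendsto_natCast_atTop_atTop).eventually_ge_atTop 1
  have hbig : ∀ᶠ n : ℕ in atTop, α ^ 2 ≤ (n : ℝ) :=
    tendsto_natCast_atTop_atTop.eventually_ge_atTop _
  filter_upwards [hlim.eventually_ge_atTop 1, hlog, hbig, eventually_gt_atTop 0]
    with n h1 h2 h3 h4
  have hn : (0 : ℝ) < n := by exact_mod_cast h4
  have hr := hrpos n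
  have hrn := hrα n
  rw [le_div_iff₀ (by linarith)] at h1
  set K : ℝ := r n ^ ((1 : ℝ) / 3) * (n : ℝ) ^ ((2 : ℝ) / 3) with hK
  set D : ℝ := (α ^ 4 / 8) ^ ((1 : ℝ) / 3) with hD
  have hKpos : 0 < K := by positivity
  have hDpos : 0 < D := by positivity
  have hK3 : K ^ 3 = r n * (n : ℝ) ^ 2 := by
    rw [hK, mul_pow, ← Real.rpow_natCast, ← Real.rpow_natCast, ← Real.rpow_mul hr.le,
      ← Real.rpow_mul hn.le, ← Real.rpow_natCast]
    norm_num
  have hD3 : D ^ 3 = α ^ 4 / 8 := by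
    rw [hD, ← Real.rpow_natCast, ← Real.rpow_mul (by positivity)]
    norm_num
  have hrn2 : α ≤ r n * (n : ℝ) ^ 2 := by
    have a1 : 1 ≤ n * r n ^ 2 := by linarith
    have a2 : n * r n ^ 2 ≤ n * (r n * α) := by
      rw [sq]; gcongr
    have a3 : α ^ 2 * 1 ≤ n * (n * (r n * α)) := by
      apply mul_le_mul h3 (a1.trans a2) (by norm_num) hn.le
    have : α * α ≤ α * (r n * (n : ℝ) ^ 2) := by nlinarith
    exact le_of_mul_le_mul_left this hα
  have hdα : D / K ≤ α := by
    rw [div_le_iff₀ hKpos]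
    apply le_of_pow_le_pow_left₀ (n := 3) (by norm_num) (by positivity)
    rw [mul_pow, hK3, hD3]
    have : α ^ 3 * α ≤ α ^ 3 * (r n * (n : ℝ) ^ 2) := by gcongr
    nlinarith [pow_pos hα 4]
  have key := main_bound α hα P hP (r n) (D / K) hr (by positivity) hdα n h4 (by
    rw [div_pow, hD3, hK3]; field_simp)
  calc ENNReal.ofReal (D * α * π / 2)
      = ENNReal.ofReal K * ENNReal.ofReal (D / K * α * π / 2) := by
        rw [← ENNReal.ofReal_mul hKpos.le]; congr 1; field_simp
    _ ≤ _ := by gcongr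
end
end

section
/- Let S ⊂ ℝ² be a nonempty compact set such that a closed ball of radius α > 0 rolls freely in S and in the closure of the complement of S. Let P_X be a Borel probability measure with support S such that there exist δ, β > 0 with δ·μ(C ∩ S) ≤ P_X(C) ≤ β·μ(C ∩ S) for every Borel set C ⊂ ℝ². Let X₁,…,Xₙ be i.i.d. with law P_X, let {rₙ} be a sequence of positive numbers with rₙ ≤ α and n·rₙ²/log n → ∞, and let Sₙ = (𝒳ₙ ⊕ rₙB) ⊖ rₙB. Let 𝒩ₙ denote the number of extreme points of Sₙ, i.e. the number of indices i with Xᵢ ∈ ∂Sₙ. Then E(𝒩ₙ) = O(rₙ^{-1/3}·n^{1/3}), i.e. there exist a constant C > 0 and N ∈ ℕ such that for all n ≥ N, E(𝒩ₙ) ≤ C·rₙ^{-1/3}·n^{1/3}. -/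
open MeasureTheory Metric Set Filter
open scoped RealInnerProductSpace symmDiff ENNReal Pointwise Real

noncomputable section

/-- Equality case of the triangle inequality. -/
lemma aux_strict (u v : E2) (d α : ℝ) (hd : 0 ≤ d) (hα : 0 < α) (hu : ‖u‖ ≤ d) (hv : ‖v‖ ≤ α)
    (huv : d + α ≤ ‖u + v‖) : α • u = d • v := by
  have h1 : ‖α • u - d • v‖ ^ 2 = α ^ 2 * ‖u‖ ^ 2 - 2 * (α * d * inner ℝ u v) + d ^ 2 * ‖v‖ ^ 2 := by
    rw [norm_sub_sq_real, norm_smul, norm_smul, inner_smul_left, inner_smul_right]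
    simp only [mul_pow, Real.norm_eq_abs, sq_abs]
    simp
    ring
  have h2 := norm_add_sq_real u v
  have hu2 : ‖u‖ ^ 2 ≤ d ^ 2 := by gcongr
  have hv2 : ‖v‖ ^ 2 ≤ α ^ 2 := by gcongr
  have huv2 : (d + α) ^ 2 ≤ ‖u + v‖ ^ 2 := by gcongr
  have h3 : 2 * (d * α) ≤ 2 * inner ℝ u v := by nlinarith
  have h4 : ‖α • u - d • v‖ ^ 2 ≤ 0 := by
    rw [h1]
    have : 0 ≤ α * d := by positivity
    nlinarith [mul_le_mul_of_nonneg_left h3 this, mul_le_mul_of_nonneg_left hu2 (sq_nonneg α),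
      mul_le_mul_of_nonneg_left hv2 (sq_nonneg d)]
  have h5 : ‖α • u - d • v‖ = 0 := by
    have := sq_nonneg ‖α • u - d • v‖
    exact pow_eq_zero_iff (two_ne_zero) |>.1 (le_antisymm h4 this)
  exact sub_eq_zero.1 (norm_eq_zero.1 h5)

/-- Disjoint balls have distant centers. -/
lemma aux_disj (a b : E2) (s t : ℝ) (hs : 0 < s) (ht : 0 < t)
    (h : Disjoint (ball a s) (closedBall b t)) : s + t ≤ dist a b := by
  by_contra hlt
  push Not at hlt
  rcases eq_or_ne a b with rfl | hab
  · exact Set.disjoint_left.1 h (mem_ball_self hs) (mem_closedBall_self ht.le)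
  have hpos : 0 < dist a b := dist_pos.2 hab
  by_cases hle : dist a b ≤ t
  · exact Set.disjoint_left.1 h (mem_ball_self hs) (by simpa [mem_closedBall] using hle)
  push Not at hle
  refine Set.disjoint_left.1 h (?_ : (AffineMap.lineMap b a (t / dist a b) : E2) ∈ ball a s) ?_
  · rw [mem_ball, dist_lineMap_right]
    rw [Real.norm_eq_abs, abs_of_nonneg (by rw [sub_nonneg, div_le_one hpos]; exact hle.le),
      dist_comm b a]
    have : (1 - t / dist a b) * dist a b = dist a b - t := by field_simp
    rw [this]; linarith
  · rw [mem_closedBall, dist_lineMap_left, Real.norm_eq_abs, abs_of_nonneg (by positivity),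
      dist_comm b a]
    have : t / dist a b * dist a b = t := by field_simp
    rw [this]

lemma aux_ball_sub (S : Set E2) (x : E2) : ball x (infDist x Sᶜ) ⊆ S := by
  intro z hz
  by_contra hzS
  have : infDist x Sᶜ ≤ dist x z := infDist_le_dist_of_mem hzS
  rw [mem_ball, dist_comm] at hz
  linarith

lemma aux_cball_sub (S : Set E2) (hcl : IsClosed S) (x : E2) (hx : x ∈ S) (t : ℝ)
    (ht : t ≤ infDist x Sᶜ) : closedBall x t ⊆ S := by
  refine (closedBall_subset_closedBall ht).trans ?_
  rcases eq_or_ne (infDist x Sᶜ) 0 with h0 | h0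
  · rw [h0, closedBall_zero]; simpa using hx
  · rw [← closure_ball x h0]
    exact closure_minimal (aux_ball_sub S x) hcl

/-- Main geometric lemma. -/
lemma aux_center (S : Set E2) (hcl : IsClosed S) (hne : (Sᶜ).Nonempty) (α : ℝ) (hα : 0 < α)
    (hrollS : rollsFreely α S) (hrollSc : rollsFreely α (closure Sᶜ)) (x : E2) (hx : x ∈ S)
    (hd : infDist x Sᶜ < α) :
    ∃ c, closedBall c α ⊆ S ∧ dist x c = α - infDist x Sᶜ := by
  set d := infDist x Sᶜ with hddef
  have hd0 : 0 ≤ d := infDist_nonneg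
  obtain ⟨p, hp, hpd⟩ := (isClosed_closure (s := Sᶜ)).exists_infDist_eq_dist hne.closure x
  rw [infDist_closure, ← hddef] at hpd
  have hpS : p ∈ S := aux_cball_sub S hcl x hx d le_rfl (by rw [mem_closedBall, dist_comm, hpd])
  have hpf : p ∈ frontier S := by
    rw [frontier_eq_closure_inter_closure]; exact ⟨subset_closure hpS, hp⟩
  obtain ⟨c, hpc, hcS⟩ := hrollS p hpf
  have hcint : ball c α ⊆ interior S := interior_maximal (ball_subset_closedBall.trans hcS) isOpen_ball
  have hpf2 : p ∈ frontier (closure Sᶜ) := by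
    rw [frontier_eq_closure_inter_closure, closure_closure]
    refine ⟨hp, ?_⟩
    rw [closure_compl (s := S), compl_compl]
    rw [← closure_ball c hα.ne'] at hpc
    exact closure_mono hcint hpc
  obtain ⟨q, hpq, hqS⟩ := hrollSc p hpf2
  rw [closure_compl] at hqS
  have h1 : α + α ≤ dist c q := by
    refine aux_disj c q α α hα hα ?_
    exact Set.disjoint_left.2 fun z hz hz' => hqS hz' (hcint hz)
  have h2 : d + α ≤ dist x q := by
    rcases hd0.eq_or_lt with h0 | h0
    · have hxp : x = p := by rw [← h0] at hpd; exact dist_eq_zero.1 hpd.symm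
      have := dist_triangle c p q
      rw [mem_closedBall] at hpc hpq
      rw [dist_comm] at hpc
      rw [← h0, hxp]; linarith
    · refine aux_disj x q d α h0 hα ?_
      exact Set.disjoint_left.2 fun z hz hz' => hqS hz'
        (interior_maximal (aux_ball_sub S x) isOpen_ball hz)
  rw [mem_closedBall] at hpc hpq
  have e1 := aux_strict (c - p) (p - q) α α hα.le hα (by rwa [← dist_eq_norm, dist_comm])
    (by rwa [← dist_eq_norm]) (by rwa [sub_add_sub_cancel, ← dist_eq_norm])
  have e2 := aux_strict (x - p) (p - q) d α hd0 hα (by rw [← dist_eq_norm, hpd])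
    (by rwa [← dist_eq_norm]) (by rwa [sub_add_sub_cancel, ← dist_eq_norm])
  have e1' : c - p = p - q := smul_right_injective _ hα.ne' e1
  have hpq' : dist c p = α := by
    have := dist_triangle c p q
    rw [dist_comm] at hpc
    linarith
  refine ⟨c, hcS, ?_⟩
  have e3 : α • (x - c) = (d - α) • (c - p) := by
    have : x - c = (x - p) - (c - p) := by abel
    rw [this, smul_sub, e2, ← e1', sub_smul]
  have e4 := congrArg norm e3
  rw [norm_smul, norm_smul, ← dist_eq_norm x c, ← dist_eq_norm c p, hpq', Real.norm_eq_abs, Real.norm_eq_abs,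
    abs_of_pos hα, abs_of_neg (by linarith)] at e4
  have : α * (dist x c) = α * (α - d) := by rw [e4]; ring
  exact mul_left_cancel₀ hα.ne' this

lemma aux_center_le (S : Set E2) (hne : (Sᶜ).Nonempty) (α : ℝ) (c x : E2)
    (hc : closedBall c α ⊆ S) : α - infDist x Sᶜ ≤ dist x c := by
  have : α - dist x c ≤ infDist x Sᶜ := by
    rw [le_infDist hne]
    intro z hz
    by_contra hlt
    push Not at hlt
    apply hz
    apply hc
    rw [mem_closedBall]
    have := dist_triangle z x c
    rw [dist_comm z x] at this
    linarith
  linarith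

/-- version with radius `r ≤ α` -/
lemma aux_center_r (S : Set E2) (hcl : IsClosed S) (hne : (Sᶜ).Nonempty) (α : ℝ) (hα : 0 < α)
    (hrollS : rollsFreely α S) (hrollSc : rollsFreely α (closure Sᶜ)) (x : E2) (hx : x ∈ S)
    (r : ℝ) (hrα : r ≤ α) :
    ∃ c, closedBall c r ⊆ S ∧ dist x c = r - min (infDist x Sᶜ) r := by
  rcases le_or_gt r (infDist x Sᶜ) with h | h
  · refine ⟨x, aux_cball_sub S hcl x hx r h, ?_⟩
    simp [h]
  · obtain ⟨c, hc, hxc⟩ := aux_center S hcl hne α hα hrollS hrollSc x hx (by linarith)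
    rw [min_eq_left h.le]
    set d := infDist x Sᶜ
    have had : 0 < α - d := by linarith
    refine ⟨AffineMap.lineMap x c ((r - d) / (α - d)), ?_, ?_⟩
    · refine Subset.trans (closedBall_subset_closedBall' ?_) hc
      rw [dist_lineMap_right, hxc, Real.norm_eq_abs, abs_of_nonneg]
      · have : (1 - (r - d) / (α - d)) * (α - d) = α - r := by field_simp; ring
        rw [this]; linarith
      · rw [sub_nonneg, div_le_one had]; linarith
    · rw [dist_left_lineMap, hxc, Real.norm_eq_abs, abs_of_nonneg (by apply div_nonneg <;> linarith)]
      field_simp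

lemma aux_kneser_lip (x x' c c' : E2) (s : ℝ) (hs0 : 0 ≤ s) (hs1 : s ≤ 1)
    (h : dist x c ≤ dist x c') (h' : dist x' c' ≤ dist x' c) :
    s * dist x x' ≤ dist (c + s • (x - c)) (c' + s • (x' - c')) := by
  have hin : 0 ≤ inner ℝ (x - x') (c - c') := by
    rw [dist_eq_norm, dist_eq_norm] at h h'
    have h2 : ‖x - c‖ ^ 2 ≤ ‖x - c'‖ ^ 2 := by gcongr
    have h2' : ‖x' - c'‖ ^ 2 ≤ ‖x' - c‖ ^ 2 := by gcongr
    rw [norm_sub_sq_real, norm_sub_sq_real] at h2 h2'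
    rw [inner_sub_left, inner_sub_right, inner_sub_right]
    linarith
  rw [dist_eq_norm, dist_eq_norm]
  have e : c + s • (x - c) - (c' + s • (x' - c')) = s • (x - x') + (1 - s) • (c - c') := by
    module
  rw [e]
  refine le_of_sq_le_sq ?_ (norm_nonneg _)
  rw [norm_add_sq_real, inner_smul_left, inner_smul_right, norm_smul s, Real.norm_eq_abs,
    abs_of_nonneg hs0]
  have h1 : 0 ≤ s * ((1 - s) * inner ℝ (x - x') (c - c')) := by
    have : 0 ≤ 1 - s := by linarith
    positivity
  simp only [conj_trivial]
  nlinarith [sq_nonneg ‖(1 - s) • (c - c')‖]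

lemma aux_vol_lip (T : Set E2) (f : E2 → E2)
    (hf : ∀ x ∈ T, ∀ y ∈ T, dist x y ≤ 2 * dist (f x) (f y)) :
    (volume : Measure E2) T ≤ 4 * (volume : Measure E2) (f '' T) := by
  have hinj : InjOn f T := by
    intro x hx y hy hxy
    have := hf x hx y hy
    rw [hxy, dist_self, mul_zero] at this
    exact dist_le_zero.1 this
  rcases T.eq_empty_or_nonempty with rfl | hne
  · simp
  have hL : LipschitzOnWith 2 (Function.invFunOn f T) (f '' T) := by
    rw [lipschitzOnWith_iff_dist_le_mul]
    rintro _ ⟨x, hx, rfl⟩ _ ⟨y, hy, rfl⟩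
    rw [hinj.leftInvOn_invFunOn hx, hinj.leftInvOn_invFunOn hy]
    exact hf x hx y hy
  have him : Function.invFunOn f T '' (f '' T) = T := hinj.leftInvOn_invFunOn.image_image
  have hH := hL.hausdorffMeasure_image_le (d := 2) (by norm_num)
  rw [him] at hH
  have hv : ∃ k : ℝ≥0∞, (volume : Measure E2) = k • Measure.hausdorffMeasure 2 := by
    have : (Measure.hausdorffMeasure 2 : Measure E2).IsAddHaarMeasure := by
      simpa using MeasureTheory.isAddHaarMeasure_hausdorffMeasure (E := E2)
    exact ⟨_, Measure.isAddLeftInvariant_eq_smul (volume : Measure E2)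
      (Measure.hausdorffMeasure 2)⟩
  obtain ⟨k, hk⟩ := hv
  rw [hk, Measure.smul_apply, Measure.smul_apply, smul_eq_mul, smul_eq_mul]
  calc k * Measure.hausdorffMeasure 2 T ≤ k * (_ * Measure.hausdorffMeasure 2 (f '' T)) := by gcongr
    _ = _ := by
      have : ((2 : NNReal) : ℝ≥0∞) ^ (2 : ℝ) = 4 := by
        norm_num
      rw [this]; ring

lemma aux_tube_one (S : Set E2) (hcl : IsClosed S) (hne : (Sᶜ).Nonempty) (α : ℝ) (hα : 0 < α)
    (hrollS : rollsFreely α S) (hrollSc : rollsFreely α (closure Sᶜ)) (t : ℝ) (ht : t ≤ α)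
    (s : ℝ) (hs : 1 / 2 ≤ s) (hs1 : s ≤ 1) :
    (volume : Measure E2) {x | x ∈ S ∧ infDist x Sᶜ < t} ≤
      4 * (volume : Measure E2) (S ∩ {y | s * (α - t) < infDist y {c | closedBall c α ⊆ S} ∧
        infDist y {c | closedBall c α ⊆ S} ≤ s * α}) := by
  have hc : ∀ x : E2, ∃ c, (x ∈ S ∧ infDist x Sᶜ < t) →
      (closedBall c α ⊆ S ∧ dist x c = α - infDist x Sᶜ) := by
    intro x
    by_cases hx : x ∈ S ∧ infDist x Sᶜ < t
    · obtain ⟨c, hc⟩ := aux_center S hcl hne α hα hrollS hrollSc x hx.1 (by linarith [hx.2])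
      exact ⟨c, fun _ => hc⟩
    · exact ⟨x, fun h => absurd h hx⟩
  choose c hc using hc
  refine (aux_vol_lip _ (fun x => c x + s • (x - c x)) ?_).trans ?_
  · intro x hx y hy
    obtain ⟨hx1, hx2⟩ := hc x hx
    obtain ⟨hy1, hy2⟩ := hc y hy
    have := aux_kneser_lip x y (c x) (c y) s (by linarith) hs1
      (hx2 ▸ aux_center_le S hne α (c y) x hy1) (hy2 ▸ aux_center_le S hne α (c x) y hx1)
    have h0 : 0 ≤ dist x y := dist_nonneg
    nlinarith
  · gcongr
    rintro _ ⟨x, hx, rfl⟩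
    obtain ⟨hx1, hx2⟩ := hc x hx
    have hd0 : 0 ≤ infDist x Sᶜ := infDist_nonneg
    have hdx : 0 ≤ dist x (c x) := dist_nonneg
    have e1 : dist (c x + s • (x - c x)) (c x) = s * dist x (c x) := by
      rw [dist_eq_norm, add_sub_cancel_left, norm_smul, ← dist_eq_norm x (c x), Real.norm_eq_abs,
        abs_of_nonneg (by linarith)]
    have e2 : dist x (c x + s • (x - c x)) = (1 - s) * dist x (c x) := by
      have : x - (c x + s • (x - c x)) = (1 - s) • (x - c x) := by module
      rw [dist_eq_norm, this, norm_smul, ← dist_eq_norm x (c x), Real.norm_eq_abs,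
        abs_of_nonneg (by linarith)]
    have hinf : infDist (c x + s • (x - c x)) {c | closedBall c α ⊆ S} = s * dist x (c x) := by
      apply le_antisymm
      · rw [← e1]
        exact infDist_le_dist_of_mem hx1
      · rw [le_infDist ⟨c x, hx1⟩]
        intro a ha
        have h1 := aux_center_le S hne α a x ha
        have h2 := dist_triangle x (c x + s • (x - c x)) a
        rw [e2] at h2
        nlinarith
    refine ⟨hx1 ?_, ?_⟩
    · rw [mem_closedBall]
      dsimp only
      rw [e1]; nlinarith
    · simp only [mem_ofPred_eq]
      rw [hinf, hx2]
      have := hx.2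
      constructor <;> nlinarith

lemma aux_tube (S : Set E2) (hcomp : IsCompact S) (hne : (Sᶜ).Nonempty) (α : ℝ) (hα : 0 < α)
    (hrollS : rollsFreely α S) (hrollSc : rollsFreely α (closure Sᶜ)) (t : ℝ) (ht : 0 < t) :
    (volume : Measure E2) {x | x ∈ S ∧ infDist x Sᶜ < t} ≤
      ENNReal.ofReal (16 * (volume : Measure E2).real S / α * t) := by
  have hfin : (volume : Measure E2) S ≠ ∞ := hcomp.measure_lt_top.ne
  have hle : (volume : Measure E2) {x | x ∈ S ∧ infDist x Sᶜ < t} ≤ volume S :=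
    measure_mono fun x hx => hx.1
  have hVT : (volume : Measure E2) {x | x ∈ S ∧ infDist x Sᶜ < t} ≠ ∞ :=
    (hle.trans_lt hcomp.measure_lt_top).ne
  rw [← ENNReal.ofReal_toReal hVT]
  apply ENNReal.ofReal_le_ofReal
  have hV0 : 0 ≤ (volume : Measure E2).real S := measureReal_nonneg
  rcases le_or_gt t (α / 2) with h | h
  swap
  · have h1 : ((volume : Measure E2) {x | x ∈ S ∧ infDist x Sᶜ < t}).toReal ≤ volume.real S :=
      ENNReal.toReal_mono hfin hle
    refine h1.trans ?_
    rw [div_mul_eq_mul_div, le_div_iff₀ hα]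
    nlinarith
  set K := ⌊α / (2 * t)⌋₊ with hK
  have hu : 1 ≤ α / (2 * t) := by rw [le_div_iff₀ (by positivity)]; linarith
  have hKle : (K : ℝ) ≤ α / (2 * t) := Nat.floor_le (by positivity)
  have hKge : α / (2 * t) / 2 ≤ K := by
    have h1 : α / (2 * t) < K + 1 := Nat.lt_floor_add_one _
    have h2 : 1 ≤ K := Nat.le_floor (by simpa using hu)
    have h3 : (1 : ℝ) ≤ K := by exact_mod_cast h2
    linarith
  let R : ℕ → Set E2 := fun k => S ∩ {y | (1 - k * t / α) * (α - t) < infDist y {c | closedBall c α ⊆ S} ∧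
        infDist y {c | closedBall c α ⊆ S} ≤ (1 - k * t / α) * α}
  have hR : ∀ k ∈ Finset.range K, (volume : Measure E2) {x | x ∈ S ∧ infDist x Sᶜ < t} ≤ 4 * volume (R k) := by
    intro k hk
    have hk' : (k : ℝ) ≤ K := by exact_mod_cast (Finset.mem_range.1 hk).le
    refine aux_tube_one S hcomp.isClosed hne α hα hrollS hrollSc t (by linarith) _ ?_ ?_
    · have : (k : ℝ) * t / α ≤ 1 / 2 := by
        rw [div_le_iff₀ hα]
        have h4 := hk'.trans hKle
        rw [le_div_iff₀ (by positivity)] at h4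
        linarith
      linarith
    · have : 0 ≤ (k : ℝ) * t / α := by positivity
      linarith
  have hmeas : ∀ k, MeasurableSet (R k) := by
    intro k
    refine hcomp.isClosed.measurableSet.inter ?_
    exact (measurableSet_lt measurable_const (continuous_infDist_pt _).measurable).inter
      (measurableSet_le (continuous_infDist_pt _).measurable measurable_const)
  have hdis : ∀ k l : ℕ, k < l → Disjoint (R k) (R l) := by
    intro k l hkl
    rw [Set.disjoint_left]
    rintro y ⟨_, hy1, _⟩ ⟨_, _, hy2⟩
    have hkl' : (k : ℝ) + 1 ≤ l := by exact_mod_cast hkl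
    have e1 : (1 - l * t / α) * α = α - l * t := by field_simp
    have e2 : (1 - k * t / α) * (α - t) = α - k * t - t + k * t ^ 2 / α := by field_simp; ring
    rw [e1] at hy2
    rw [e2] at hy1
    have : 0 ≤ k * t ^ 2 / α := by positivity
    nlinarith
  have hsum : ∑ k ∈ Finset.range K, (volume : Measure E2) (R k) ≤ volume S := by
    rw [← measure_biUnion_finset (fun k _ l _ hkl => ?_) (fun k _ => hmeas k)]
    · exact measure_mono (iUnion₂_subset fun k _ => inter_subset_left)
    · rcases lt_or_gt_of_ne hkl with h | h
      · exact hdis k l h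
      · exact (hdis l k h).symm
  have htot : (K : ℝ≥0∞) * (volume : Measure E2) {x | x ∈ S ∧ infDist x Sᶜ < t} ≤ 4 * volume S := by
    calc _ = ∑ k ∈ Finset.range K, (volume : Measure E2) {x | x ∈ S ∧ infDist x Sᶜ < t} := by simp
      _ ≤ ∑ k ∈ Finset.range K, 4 * (volume : Measure E2) (R k) := Finset.sum_le_sum hR
      _ = 4 * ∑ k ∈ Finset.range K, (volume : Measure E2) (R k) := by rw [Finset.mul_sum]
      _ ≤ _ := by gcongr
  have htot' := ENNReal.toReal_mono (by finiteness) htot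
  rw [ENNReal.toReal_mul, ENNReal.toReal_mul] at htot'
  simp only [ENNReal.toReal_natCast, ENNReal.toReal_ofNat] at htot'
  set v := ((volume : Measure E2) {x | x ∈ S ∧ infDist x Sᶜ < t}).toReal
  have hv : 0 ≤ v := ENNReal.toReal_nonneg
  have h5 : α / (2 * t) / 2 * v ≤ 4 * volume.real S := (mul_le_mul_of_nonneg_right hKge hv).trans htot'
  have e : α / (2 * t) / 2 * v = α * v / (4 * t) := by field_simp; ring
  rw [e, div_le_iff₀ (by positivity)] at h5
  rw [div_mul_eq_mul_div, le_div_iff₀ hα]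
  linarith

/-- A signed interval. -/
def sgnIcc (s : Bool) (a b : ℝ) : Set ℝ := if s then Icc a b else Icc (-b) (-a)

lemma volume_sgnIcc (s : Bool) (a b : ℝ) : volume (sgnIcc s a b) = ENNReal.ofReal (b - a) := by
  unfold sgnIcc
  cases s
  · simp; congr 1; ring
  · simp

lemma measurable_sgnIcc (s : Bool) (a b : ℝ) : MeasurableSet (sgnIcc s a b) := by
  unfold sgnIcc
  split_ifs <;> exact measurableSet_Icc

lemma sgnIcc_mul (s : Bool) (a b v y : ℝ) (ha : 0 ≤ a) (hv : v ∈ sgnIcc s a b)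
    (hs : s = true ↔ 0 ≤ y) : a * |y| ≤ v * y := by
  unfold sgnIcc at hv
  cases s
  · simp at hs hv
    rw [abs_of_neg hs]; nlinarith
  · simp at hs hv
    rw [abs_of_nonneg hs]; nlinarith

lemma sgnIcc_abs (s : Bool) (a b v : ℝ) (hv : v ∈ sgnIcc s a b) (ha : 0 ≤ a) : |v| ≤ b := by
  unfold sgnIcc at hv
  cases s
  · simp at hv
    rw [abs_le]; constructor <;> linarith
  · simp at hv
    rw [abs_le]; constructor <;> linarith

lemma exists_basis (w : E2) : ∃ b : OrthonormalBasis (Fin 2) ℝ E2, w = ‖w‖ • b 0 := by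
  by_cases hw : w = 0
  · exact ⟨EuclideanSpace.basisFun (Fin 2) ℝ, by simp [hw]⟩
  · have hw' : ‖w‖ ≠ 0 := norm_ne_zero_iff.2 hw
    obtain ⟨b, hb⟩ := Orthonormal.exists_orthonormalBasis_extension_of_card_eq (𝕜 := ℝ) (E := E2)
      (ι := Fin 2) (by simp) (v := fun _ => ‖w‖⁻¹ • w) (s := {0}) (by
        constructor
        · intro i
          simp [norm_smul, hw']
        · intro i j hij
          exact absurd (Subsingleton.elim i j) hij)
    refine ⟨b, ?_⟩
    rw [hb 0 rfl, smul_smul, mul_inv_cancel₀ hw', one_smul]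

lemma aux_cap (x c : E2) (r t : ℝ) (ht : 0 < t) (htr : t ≤ r) (hxc : dist x c = r - t) :
    ∃ U : Bool × Bool → Set E2, (∀ k, MeasurableSet (U k)) ∧ (∀ k, U k ⊆ closedBall c r) ∧
      (∀ k, volume (U k) = ENNReal.ofReal (t * √(t * r) / 48)) ∧
      ∀ y, dist y x = r → ∃ k, U k ⊆ ball y r := by
  obtain ⟨b, hb⟩ := exists_basis (x - c)
  rw [← dist_eq_norm, hxc] at hb
  set q := √(t * r) with hq
  have hr : 0 < r := by linarith
  have hq2 : q ^ 2 = t * r := Real.sq_sqrt (by positivity)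
  have hqpos : 0 < q := Real.sqrt_pos.2 (by positivity)
  have hqt : t ≤ q := Real.le_sqrt_of_sq_le (by nlinarith)
  let Rect : Bool × Bool → Set (Fin 2 → ℝ) := fun k =>
    Set.pi univ ![sgnIcc k.1 (3 * t / 8) (t / 2), sgnIcc k.2 (q / 3) (q / 2)]
  have hRm : ∀ k, MeasurableSet (Rect k) := by
    intro k
    refine MeasurableSet.univ_pi fun i => ?_
    fin_cases i
    · exact measurable_sgnIcc _ _ _
    · exact measurable_sgnIcc _ _ _
  have hRv : ∀ k, volume (Rect k) = ENNReal.ofReal (t * q / 48) := by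
    intro k
    rw [volume_pi_pi, Fin.prod_univ_two]
    simp only [Matrix.cons_val_zero, Matrix.cons_val_one]
    rw [volume_sgnIcc, volume_sgnIcc, ← ENNReal.ofReal_mul (by linarith)]
    congr 1; ring
  let φ : E2 → (Fin 2 → ℝ) := fun z => WithLp.ofLp (b.repr (z - x))
  have hφ : MeasurePreserving φ volume volume :=
    (PiLp.volume_preserving_ofLp (Fin 2)).comp
      (b.measurePreserving_repr.comp (measurePreserving_sub_right volume x))
  have hnorm : ∀ w : E2, ‖w‖ ^ 2 = (b.repr w 0) ^ 2 + (b.repr w 1) ^ 2 := by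
    intro w
    rw [← b.repr.norm_map w, EuclideanSpace.norm_sq_eq, Fin.sum_univ_two]
    simp
  have hmem : ∀ k z, z ∈ φ ⁻¹' Rect k → b.repr (z - x) 0 ∈ sgnIcc k.1 (3 * t / 8) (t / 2) ∧
      b.repr (z - x) 1 ∈ sgnIcc k.2 (q / 3) (q / 2) := by
    intro k z hz
    exact ⟨hz 0 (mem_univ _), hz 1 (mem_univ _)⟩
  refine ⟨fun k => φ ⁻¹' Rect k, fun k => hφ.measurable (hRm k), ?_, ?_, ?_⟩
  · intro k z hz
    obtain ⟨h0, h1⟩ := hmem k z hz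
    have h0' := sgnIcc_abs _ _ _ _ h0 (by positivity)
    have h1' := sgnIcc_abs _ _ _ _ h1 (by positivity)
    rw [mem_closedBall, dist_eq_norm]
    refine le_of_sq_le_sq ?_ hr.le
    have e : z - c = (z - x) + (r - t) • b 0 := by rw [← hb]; abel
    have e0 : b.repr (z - c) 0 = b.repr (z - x) 0 + (r - t) := by
      rw [e, map_add, map_smul]; simp
    have e1 : b.repr (z - c) 1 = b.repr (z - x) 1 := by
      rw [e, map_add, map_smul]; simp
    rw [hnorm, e0, e1]
    generalize b.repr (z - x) 0 = u at *
    generalize b.repr (z - x) 1 = v at *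
    have hv2 : v ^ 2 ≤ (q / 2) ^ 2 := sq_le_sq' (by linarith [(abs_le.1 h1').1]) (abs_le.1 h1').2
    have hu2 : (u + (r - t)) ^ 2 ≤ (r - t / 2) ^ 2 :=
      sq_le_sq' (by linarith [(abs_le.1 h0').1]) (by linarith [(abs_le.1 h0').2])
    nlinarith
  · intro k
    rw [hφ.measure_preimage (hRm k).nullMeasurableSet, hRv]
  · intro y hy
    refine ⟨(decide (0 ≤ b.repr (y - x) 0), decide (0 ≤ b.repr (y - x) 1)), ?_⟩
    intro z hz
    obtain ⟨h0, h1⟩ := hmem _ z hz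
    have h0' := sgnIcc_abs _ _ _ _ h0 (by positivity)
    have h1' := sgnIcc_abs _ _ _ _ h1 (by positivity)
    have m0 := sgnIcc_mul _ _ _ _ (b.repr (y - x) 0) (by positivity) h0 (by simp)
    have m1 := sgnIcc_mul _ _ _ _ (b.repr (y - x) 1) (by positivity) h1 (by simp)
    have hyn := hnorm (y - x)
    rw [← dist_eq_norm, hy] at hyn
    rw [mem_ball, dist_eq_norm]
    refine lt_of_pow_lt_pow_left₀ 2 hr.le ?_
    have e : z - y = (z - x) - (y - x) := by abel
    rw [hnorm, e, map_sub]
    simp only [PiLp.sub_apply]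
    generalize b.repr (z - x) 0 = u at *
    generalize b.repr (z - x) 1 = v at *
    generalize b.repr (y - x) 0 = y0 at *
    generalize b.repr (y - x) 1 = y1 at *
    have hu2 : u ^ 2 ≤ (t / 2) ^ 2 := sq_le_sq' (by linarith [(abs_le.1 h0').1]) (abs_le.1 h0').2
    have hv2 : v ^ 2 ≤ (q / 2) ^ 2 := sq_le_sq' (by linarith [(abs_le.1 h1').1]) (abs_le.1 h1').2
    have hsum : r ≤ |y0| + |y1| := by
      refine le_of_sq_le_sq ?_ (by positivity)
      rw [hyn, ← sq_abs y0, ← sq_abs y1]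
      nlinarith [abs_nonneg y0, abs_nonneg y1, mul_nonneg (abs_nonneg y0) (abs_nonneg y1)]
    have h5 : t / 3 * r ≤ u * y0 + v * y1 := by
      have a0 : t / 3 * |y0| ≤ 3 * t / 8 * |y0| := by
        apply mul_le_mul_of_nonneg_right _ (abs_nonneg _); linarith
      have a1 : t / 3 * |y1| ≤ q / 3 * |y1| := by
        apply mul_le_mul_of_nonneg_right _ (abs_nonneg _); linarith
      have a2 : t / 3 * r ≤ t / 3 * (|y0| + |y1|) := by
        apply mul_le_mul_of_nonneg_left hsum; linarith
      linarith
    have h6 : 0 < t * r := by positivity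
    nlinarith

/-- Pairs (point, sample) such that some ball of radius `r` avoiding the sample touches the point. -/
def touchSet (r : ℝ) (n : ℕ) : Set (E2 × (Fin n → E2)) :=
  {p | ∃ v ∈ closedBall (0 : E2) r, ∀ j, r ≤ dist (p.2 j) (p.1 + v)}

lemma isClosed_touchSet (r : ℝ) (n : ℕ) : IsClosed (touchSet r n) := by
  have : touchSet r n = Prod.snd '' {w : (closedBall (0 : E2) r) × (E2 × (Fin n → E2)) |
      ∀ j, r ≤ dist (w.2.2 j) (w.2.1 + w.1)} := by
    ext p
    constructor
    · rintro ⟨v, hv, h⟩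
      exact ⟨(⟨v, hv⟩, p), h, rfl⟩
    · rintro ⟨⟨v, p'⟩, h, rfl⟩
      exact ⟨v, v.2, h⟩
  rw [this]
  have : CompactSpace (closedBall (0 : E2) r) := isCompact_iff_compactSpace.1 (isCompact_closedBall _ _)
  apply isClosedMap_snd_of_compactSpace
  rw [show {w : (closedBall (0 : E2) r) × (E2 × (Fin n → E2)) |
      ∀ j, r ≤ dist (w.2.2 j) (w.2.1 + w.1)} =
      ⋂ j, {w | r ≤ dist (w.2.2 j) (w.2.1 + (w.1 : E2))} by
    ext; simp]
  refine isClosed_iInter fun j => isClosed_le continuous_const ?_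
  fun_prop

lemma frontier_touch (r : ℝ) (hr : 0 ≤ r) (n : ℕ) (X : Fin n → E2) (x : E2)
    (hx : x ∈ frontier (estimator r X)) : (x, X) ∈ touchSet r n := by
  rw [frontier_eq_closure_inter_closure] at hx
  have hcl : IsClosed {z : E2 | (z, X) ∈ touchSet r n} :=
    (isClosed_touchSet r n).preimage (f := fun z : E2 => (z, X)) (by fun_prop)
  refine closure_minimal ?_ hcl hx.2
  intro z hz
  have hB : r • closedBall (0 : E2) 1 = closedBall 0 r := by
    rw [_root_.smul_closedBall _ _ zero_le_one]; simp [abs_of_nonneg hr]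
  simp only [estimator, minkSub, mem_compl_iff, mem_ofPred_eq, hB] at hz
  rw [Set.not_subset] at hz
  obtain ⟨w, ⟨a, ha, v, hv, rfl⟩, hw⟩ := hz
  rw [mem_singleton_iff] at ha
  subst ha
  refine ⟨v, hv, fun j => ?_⟩
  by_contra hlt
  push Not at hlt
  apply hw
  refine ⟨X j, mem_range_self j, a + v - X j, ?_, by abel⟩
  rw [mem_closedBall, dist_zero_right, ← dist_eq_norm, dist_comm]
  exact hlt.le

/-- The event that sample point `i` is touched by an empty ball. -/
def touchEv (r : ℝ) (n : ℕ) (i : Fin n) : Set (Fin n → E2) := {X | (X i, X) ∈ touchSet r n}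

lemma measurable_touchEv (r : ℝ) (n : ℕ) (i : Fin n) : MeasurableSet (touchEv r n i) := by
  apply IsClosed.measurableSet
  exact (isClosed_touchSet r n).preimage (f := fun X : Fin n → E2 => (X i, X)) (by fun_prop)

lemma expect_le (r : ℝ) (hr : 0 ≤ r) (n : ℕ) (Q : Measure (Fin n → E2)) :
    (∫⁻ X : Fin n → E2, (({i : Fin n | X i ∈ frontier (estimator r X)}.ncard : ℝ≥0∞)) ∂Q)
      ≤ ∑ i, Q (touchEv r n i) := by
  classical
  calc _ ≤ ∫⁻ X : Fin n → E2, ∑ i, (touchEv r n i).indicator (fun _ => (1 : ℝ≥0∞)) X ∂Q := by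
        apply lintegral_mono
        intro X
        have h1 : {i : Fin n | X i ∈ frontier (estimator r X)} ⊆
            ((Finset.univ.filter fun i => X ∈ touchEv r n i : Finset (Fin n)) : Set (Fin n)) := by
          intro i hi
          simp only [Finset.coe_filter, Finset.mem_univ, true_and, mem_ofPred_eq]
          exact frontier_touch r hr n X (X i) hi
        have h2 := Set.ncard_le_ncard h1 (Finset.finite_toSet _)
        rw [Set.ncard_coe_finset] at h2
        calc (({i : Fin n | X i ∈ frontier (estimator r X)}.ncard : ℝ≥0∞))
            ≤ ((Finset.univ.filter fun i => X ∈ touchEv r n i).card : ℝ≥0∞) := by exact_mod_cast h2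
          _ = _ := by
            simp [Set.indicator_apply]
    _ = ∑ i, Q (touchEv r n i) := by
        rw [lintegral_finsetSum _ (fun i _ => measurable_const.indicator (measurable_touchEv r n i))]
        refine Finset.sum_congr rfl fun i _ => ?_
        rw [lintegral_indicator (measurable_touchEv r n i)]
        simp

lemma section_bound (S : Set E2) (hcl : IsClosed S) (hne : (Sᶜ).Nonempty) (α : ℝ) (hα : 0 < α)
    (hrollS : rollsFreely α S) (hrollSc : rollsFreely α (closure Sᶜ))
    (P : Measure E2) [IsProbabilityMeasure P] (δ : ℝ) (hδ : 0 < δ)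
    (hlow : ∀ C : Set E2, MeasurableSet C → ENNReal.ofReal δ * volume (C ∩ S) ≤ P C)
    (r : ℝ) (hr : 0 < r) (hrα : r ≤ α) (m : ℕ) (i : Fin (m + 1)) (x : E2) (hx : x ∈ S) :
    (Measure.pi fun _ : Fin m => P) {X' | (i.insertNth x X' : Fin (m + 1) → E2) ∈ touchEv r (m + 1) i} ≤
      ENNReal.ofReal (4 * Real.exp (-(m * (δ * (min (infDist x Sᶜ) r *
        √(min (infDist x Sᶜ) r * r) / 48))))) := by
  obtain ⟨c, hcS, hxc⟩ := aux_center_r S hcl hne α hα hrollS hrollSc x hx r hrα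
  set t := min (infDist x Sᶜ) r with htdef
  have ht0 : 0 ≤ t := le_min infDist_nonneg hr.le
  rcases ht0.eq_or_lt with h0 | htpos
  · rw [← h0]
    simp only [zero_mul, zero_div, mul_zero, neg_zero, Real.exp_zero, mul_one]
    refine prob_le_one.trans ?_
    rw [show ENNReal.ofReal 4 = 4 by simp]
    norm_num
  obtain ⟨U, hUm, hUc, hUv, hU⟩ := aux_cap x c r t htpos (min_le_right _ _) hxc
  set a := δ * (t * √(t * r) / 48) with ha
  have hPU : ∀ k, ENNReal.ofReal a ≤ P (U k) := by
    intro k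
    have h1 := hlow (U k) (hUm k)
    rw [inter_eq_self_of_subset_left ((hUc k).trans hcS), hUv k, ← ENNReal.ofReal_mul hδ.le] at h1
    exact h1
  have hPUc : ∀ k, P (U k)ᶜ ≤ ENNReal.ofReal (Real.exp (-a)) := by
    intro k
    rw [prob_compl_eq_one_sub (hUm k)]
    calc 1 - P (U k) ≤ 1 - ENNReal.ofReal a := tsub_le_tsub_left (hPU k) _
      _ = ENNReal.ofReal (1 - a) := by
        rw [ENNReal.ofReal_sub _ (by positivity), ENNReal.ofReal_one]
      _ ≤ _ := ENNReal.ofReal_le_ofReal (by linarith [Real.add_one_le_exp (-a)])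
  have hsub : {X' : Fin m → E2 | (i.insertNth x X' : Fin (m + 1) → E2) ∈ touchEv r (m + 1) i} ⊆
      ⋃ k, Set.pi univ (fun _ : Fin m => (U k)ᶜ) := by
    rintro X' ⟨v, hv, hX⟩
    simp only [Fin.insertNth_apply_same] at hX
    have hi := hX i
    simp only [Fin.insertNth_apply_same] at hi
    rw [mem_closedBall, dist_zero_right] at hv
    have hvr : dist (x + v) x = r := by
      apply le_antisymm
      · simpa [dist_eq_norm] using hv
      · rwa [dist_comm]
    obtain ⟨k, hk⟩ := hU _ hvr
    rw [mem_iUnion]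
    refine ⟨k, fun j _ hj => ?_⟩
    have h2 := hX (i.succAbove j)
    simp only [Fin.insertNth_apply_succAbove] at h2
    have h3 := hk hj
    rw [mem_ball] at h3
    linarith
  refine (measure_mono hsub).trans ((measure_iUnion_fintype_le _ _).trans ?_)
  calc ∑ k, (Measure.pi fun _ : Fin m => P) (Set.pi univ (fun _ : Fin m => (U k)ᶜ))
      ≤ ∑ k : Bool × Bool, ENNReal.ofReal (Real.exp (-(m * a))) := by
        refine Finset.sum_le_sum fun k _ => ?_
        rw [Measure.pi_pi, Finset.prod_const, Finset.card_univ, Fintype.card_fin]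
        calc P (U k)ᶜ ^ m ≤ (ENNReal.ofReal (Real.exp (-a))) ^ m := by gcongr; exact hPUc k
          _ = _ := by
            rw [← ENNReal.ofReal_pow (Real.exp_pos _).le, ← Real.exp_nat_mul]
            congr 2; ring
    _ = _ := by
        rw [Finset.sum_const, Finset.card_univ, ENNReal.ofReal_mul (by norm_num)]
        simp

lemma ev_bound (P : Measure E2) [IsProbabilityMeasure P] (r : ℝ) (m : ℕ) (i : Fin (m + 1))
    (G : E2 → ℝ≥0∞) (S : Set E2) (hPS : P Sᶜ = 0)
    (hG : ∀ x ∈ S, (Measure.pi fun _ : Fin m => P)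
      {X' | (i.insertNth x X' : Fin (m + 1) → E2) ∈ touchEv r (m + 1) i} ≤ G x) :
    (Measure.pi fun _ : Fin (m + 1) => P) (touchEv r (m + 1) i) ≤ ∫⁻ x, G x ∂P := by
  have h := (measurePreserving_piFinSuccAbove (fun _ : Fin (m + 1) => P) i).symm
  rw [← h.measure_preimage (measurable_touchEv r (m + 1) i).nullMeasurableSet,
    Measure.prod_apply (h.measurable (measurable_touchEv r (m + 1) i))]
  apply lintegral_mono_ae
  have hae : ∀ᵐ x ∂P, x ∈ S := by
    rw [ae_iff]; exact hPS
  filter_upwards [hae] with x hx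
  exact hG x hx

lemma pointwise_tail (M r h d : ℝ) (hM : 0 < M) (hr : 0 < r) (hh : 0 < h) (hd : 0 ≤ d)
    (hMh : 1 ≤ M * (h * √(h * r))) :
    ENNReal.ofReal (Real.exp (-(M * (min d r * √(min d r * r))))) ≤
      ENNReal.ofReal (Real.exp (-(M * r ^ 2))) +
        ∑' k : ℕ, ENNReal.ofReal (Real.exp (-(k : ℝ))) * (if d < (k + 1) * h then 1 else 0) := by
  rcases le_or_gt r d with hrd | hrd
  · rw [min_eq_right hrd, Real.sqrt_mul_self hr.le]
    refine le_trans (le_of_eq ?_) le_self_add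
    congr 3; ring
  · rw [min_eq_left hrd.le]
    refine le_trans ?_ le_add_self
    refine le_trans ?_ (ENNReal.le_tsum ⌊d / h⌋₊)
    have h1 : d / h < ⌊d / h⌋₊ + 1 := Nat.lt_floor_add_one _
    rw [div_lt_iff₀ hh] at h1
    have h2 : (⌊d / h⌋₊ : ℝ) ≤ d / h := Nat.floor_le (by positivity)
    rw [le_div_iff₀ hh] at h2
    rw [if_pos h1, mul_one]
    apply ENNReal.ofReal_le_ofReal
    apply Real.exp_le_exp.2
    apply neg_le_neg
    rcases Nat.eq_zero_or_pos ⌊d / h⌋₊ with h0 | h0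
    · rw [h0]; simp; positivity
    · have h0' : (1 : ℝ) ≤ ⌊d / h⌋₊ := by exact_mod_cast h0
      generalize (⌊d / h⌋₊ : ℝ) = k at *
      have hhd : h ≤ d := by nlinarith
      have hs : √(h * r) ≤ √(d * r) := by gcongr
      calc k = k * 1 := by ring
        _ ≤ k * (M * (h * √(h * r))) := by gcongr
        _ = M * (k * h * √(h * r)) := by ring
        _ ≤ M * (d * √(d * r)) := by gcongr

/-- The numerical constant. -/
def tailConst : ℝ := ∑' k : ℕ, Real.exp (-(k : ℝ)) * (k + 1)

lemma tail_summable : Summable fun k : ℕ => Real.exp (-(k : ℝ)) * (k + 1) := by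
  have h1 := Real.summable_pow_mul_exp_neg_nat_mul 1 (r := 1) one_pos
  have h2 := Real.summable_pow_mul_exp_neg_nat_mul 0 (r := 1) one_pos
  refine (h1.add h2).congr fun k => ?_
  simp; ring

lemma tail_int (S : Set E2) (hS : MeasurableSet S) (C0 : ℝ) (hC0 : 0 ≤ C0)
    (htube : ∀ t > 0, (volume : Measure E2) {x | x ∈ S ∧ infDist x Sᶜ < t} ≤ ENNReal.ofReal (C0 * t))
    (hfin : (volume : Measure E2) S ≠ ∞)
    (M r h : ℝ) (hM : 0 < M) (hr : 0 < r) (hh : 0 < h)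
    (hMh : 1 ≤ M * (h * √(h * r))) :
    ∫⁻ x in S, ENNReal.ofReal (Real.exp (-(M * (min (infDist x Sᶜ) r *
      √(min (infDist x Sᶜ) r * r))))) ≤
      ENNReal.ofReal (Real.exp (-(M * r ^ 2)) * (volume : Measure E2).real S + C0 * tailConst * h) := by
  have htc : 0 ≤ tailConst := tsum_nonneg fun k => by positivity
  have hdm : Measurable fun x : E2 => infDist x Sᶜ := (continuous_infDist_pt _).measurable
  have hms : ∀ k : ℕ, MeasurableSet {x : E2 | infDist x Sᶜ < (k + 1) * h} := fun k =>
    measurableSet_lt hdm measurable_const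
  calc _ ≤ ∫⁻ x in S, (ENNReal.ofReal (Real.exp (-(M * r ^ 2))) +
        ∑' k : ℕ, ENNReal.ofReal (Real.exp (-(k : ℝ))) *
          (if infDist x Sᶜ < (k + 1) * h then 1 else 0)) :=
        lintegral_mono fun x => pointwise_tail M r h _ hM hr hh infDist_nonneg hMh
    _ = ENNReal.ofReal (Real.exp (-(M * r ^ 2))) * volume S +
        ∑' k : ℕ, ENNReal.ofReal (Real.exp (-(k : ℝ))) *
          volume {x | x ∈ S ∧ infDist x Sᶜ < (k + 1) * h} := by
        rw [lintegral_add_left measurable_const, lintegral_const, Measure.restrict_apply_univ,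
          lintegral_tsum]
        · congr 1
          refine tsum_congr fun k => ?_
          rw [lintegral_const_mul _ (Measurable.ite (hms k) measurable_const measurable_const)]
          congr 1
          have : (fun x : E2 => if infDist x Sᶜ < (k + 1) * h then (1 : ℝ≥0∞) else 0) =
              {x : E2 | infDist x Sᶜ < (k + 1) * h}.indicator (fun _ => 1) := by
            ext x; simp [Set.indicator_apply]
          rw [this, lintegral_indicator (hms k)]
          rw [lintegral_const, one_mul, Measure.restrict_apply_univ, Measure.restrict_apply (hms k)]
          congr 1
          ext x; simp [and_comm]
        · intro k
          exact ((Measurable.ite (hms k) measurable_const measurable_const).const_mul _).aemeasurable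
    _ ≤ ENNReal.ofReal (Real.exp (-(M * r ^ 2))) * volume S +
        ∑' k : ℕ, ENNReal.ofReal (C0 * h * (Real.exp (-(k : ℝ)) * (k + 1))) := by
        gcongr with k
        refine (mul_le_mul_right (htube ((k + 1) * h) (by positivity)) _).trans ?_
        rw [← ENNReal.ofReal_mul (Real.exp_pos _).le]
        apply le_of_eq; congr 1; ring
    _ = _ := by
        rw [← ENNReal.ofReal_tsum_of_nonneg (fun k => by positivity) (tail_summable.mul_left _),
          tsum_mul_left, ENNReal.ofReal_add (by positivity) (mul_nonneg (mul_nonneg hC0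
            htc) hh.le),
          ENNReal.ofReal_mul (Real.exp_pos _).le, measureReal_def, ENNReal.ofReal_toReal hfin]
        congr 2
        unfold tailConst
        ring

lemma final_real (n r α κ β V B h : ℝ) (hn : 1 ≤ n) (hr : 0 < r) (hrα : r ≤ α) (hκ : 0 < κ)
    (hβ : 0 < β) (hV : 0 ≤ V)
    (hh : h = ((n * κ) ^ 2 * r) ^ (-(1 / 3) : ℝ)) (hexp : n * Real.exp (-(n * κ * r ^ 2)) ≤ 1) :
    n * (4 * β * (Real.exp (-(n * κ * r ^ 2)) * V + B * h)) ≤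
      (4 * β * (V * α ^ (1 / 3 : ℝ) + B * (κ ^ 2) ^ (-(1 / 3) : ℝ))) *
        r ^ (-(1 / 3) : ℝ) * n ^ (1 / 3 : ℝ) := by
  have hn0 : 0 < n := by linarith
  have e1 : n * h = (κ ^ 2) ^ (-(1 / 3) : ℝ) * r ^ (-(1 / 3) : ℝ) * n ^ (1 / 3 : ℝ) := by
    rw [hh, Real.mul_rpow (by positivity) hr.le, mul_pow,
      Real.mul_rpow (by positivity) (by positivity)]
    have : n * (n ^ 2) ^ (-(1 / 3) : ℝ) = n ^ (1 / 3 : ℝ) := by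
      rw [← Real.rpow_natCast n 2, ← Real.rpow_mul hn0.le, ← Real.rpow_one_add' hn0.le (by norm_num)]
      norm_num
    rw [← this]; ring
  have e2 : 1 ≤ α ^ (1 / 3 : ℝ) * r ^ (-(1 / 3) : ℝ) * n ^ (1 / 3 : ℝ) := by
    have a1 : 1 ≤ α ^ (1 / 3 : ℝ) * r ^ (-(1 / 3) : ℝ) := by
      rw [Real.rpow_neg hr.le, ← div_eq_mul_inv, one_le_div (by positivity)]
      gcongr
    have a2 : 1 ≤ n ^ (1 / 3 : ℝ) := Real.one_le_rpow hn (by norm_num)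
    nlinarith
  have e3 : n * Real.exp (-(n * κ * r ^ 2)) * V ≤
      (α ^ (1 / 3 : ℝ) * r ^ (-(1 / 3) : ℝ) * n ^ (1 / 3 : ℝ)) * V :=
    mul_le_mul_of_nonneg_right (hexp.trans e2) hV
  calc _ = 4 * β * (n * Real.exp (-(n * κ * r ^ 2)) * V + B * (n * h)) := by ring
    _ ≤ 4 * β * ((α ^ (1 / 3 : ℝ) * r ^ (-(1 / 3) : ℝ) * n ^ (1 / 3 : ℝ)) * V + B * (n * h)) := by
      gcongr
    _ = _ := by rw [e1]; ring

theorem statement2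
    (S : Set E2) (hSne : S.Nonempty) (hScomp : IsCompact S)
    (α : ℝ) (hα : 0 < α)
    (hrollS : rollsFreely α S) (hrollSc : rollsFreely α (closure Sᶜ))
    (P : Measure E2) [IsProbabilityMeasure P]
    (hsupp : S = {x : E2 | ∀ ε > 0, 0 < P (ball x ε)})
    (δ β : ℝ) (hδ : 0 < δ) (hβ : 0 < β)
    (hlow : ∀ C : Set E2, MeasurableSet C → ENNReal.ofReal δ * volume (C ∩ S) ≤ P C)
    (hup : ∀ C : Set E2, MeasurableSet C → P C ≤ ENNReal.ofReal β * volume (C ∩ S))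
    (r : ℕ → ℝ) (hrpos : ∀ n, 0 < r n) (hrα : ∀ n, r n ≤ α)
    (hlim : Tendsto (fun n : ℕ => (n : ℝ) * (r n) ^ 2 / Real.log n) atTop atTop) :
    ∃ c > (0 : ℝ), ∃ N : ℕ, ∀ n ≥ N,
      (∫⁻ X : Fin n → E2,
          (({i : Fin n | X i ∈ frontier (estimator (r n) X)}.ncard : ℝ≥0∞))
          ∂(Measure.pi fun _ : Fin n => P))
        ≤ ENNReal.ofReal (c * (r n) ^ (-(1 / 3) : ℝ) * (n : ℝ) ^ ((1 / 3) : ℝ)) := by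
  have hne : (Sᶜ).Nonempty := nonempty_compl.2 hScomp.ne_univ
  have hcl := hScomp.isClosed
  have hSm := hcl.measurableSet
  have hPS : P Sᶜ = 0 := by
    have := hup Sᶜ hSm.compl
    simpa using this
  have hPle : P ≤ ENNReal.ofReal β • (volume : Measure E2).restrict S := by
    rw [Measure.le_iff]
    intro C hC
    rw [Measure.smul_apply, Measure.restrict_apply hC, smul_eq_mul]
    exact hup C hC
  set V := (volume : Measure E2).real S with hV
  have hV0 : 0 ≤ V := measureReal_nonneg
  set κ := δ / 96 with hκ
  have hκ0 : 0 < κ := by positivity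
  have htc : 0 ≤ tailConst := tsum_nonneg fun k => by positivity
  set B := 16 * V / α * tailConst with hB
  have hB0 : 0 ≤ B := by positivity
  set c0 := 4 * β * (V * α ^ (1 / 3 : ℝ) + B * (κ ^ 2) ^ (-(1 / 3) : ℝ)) with hc0
  have hc00 : 0 ≤ c0 := by positivity
  obtain ⟨N, hN⟩ := eventually_atTop.1 (hlim.eventually_ge_atTop (1 / κ))
  refine ⟨c0 + 1, by positivity, max N 2, fun n hn => ?_⟩
  have hnN := hN n (le_of_max_le_left hn)
  have hn2 : 2 ≤ n := le_of_max_le_right hn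
  have hn2' : (2 : ℝ) ≤ n := by exact_mod_cast hn2
  have hr := hrpos n
  have hrn := hrα n
  generalize r n = ρ at *
  have hlog : 0 < Real.log n := Real.log_pos (by linarith)
  have hexp : (n : ℝ) * Real.exp (-(n * κ * ρ ^ 2)) ≤ 1 := by
    rw [div_le_div_iff₀ hκ0 hlog, one_mul] at hnN
    have h1 : Real.exp (-(n * κ * ρ ^ 2)) ≤ Real.exp (-Real.log n) := by
      apply Real.exp_le_exp.2; linarith
    rw [Real.exp_neg (Real.log n), Real.exp_log (by linarith)] at h1
    calc (n : ℝ) * Real.exp (-(n * κ * ρ ^ 2)) ≤ n * (n : ℝ)⁻¹ := by gcongr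
      _ = 1 := by field_simp
  obtain ⟨m, rfl⟩ : ∃ m, n = m + 1 := ⟨n - 1, by omega⟩
  set M : ℝ := ((m + 1 : ℕ) : ℝ) * κ with hM
  have hM0 : 0 < M := by positivity
  set h : ℝ := (M ^ 2 * ρ) ^ (-(1 / 3) : ℝ) with hh
  have hh0 : 0 < h := by positivity
  have hh3 : h ^ 3 = (M ^ 2 * ρ)⁻¹ := by
    rw [hh, ← Real.rpow_natCast, ← Real.rpow_mul (by positivity), ← Real.rpow_neg_one]
    norm_num
  have hMh : 1 ≤ M * (h * √(h * ρ)) := by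
    have : (M * (h * √(h * ρ))) ^ 2 = 1 := by
      have hsq : √(h * ρ) ^ 2 = h * ρ := Real.sq_sqrt (by positivity)
      have e : (M * (h * √(h * ρ))) ^ 2 = M ^ 2 * h ^ 2 * √(h * ρ) ^ 2 := by ring
      have e' : M ^ 2 * h ^ 2 * (h * ρ) = h ^ 3 * (M ^ 2 * ρ) := by ring
      rw [e, hsq, e', hh3]
      exact inv_mul_cancel₀ (by positivity)
    have h0 : 0 ≤ M * (h * √(h * ρ)) := by positivity
    nlinarith
  let G : E2 → ℝ≥0∞ := fun x => ENNReal.ofReal 4 * ENNReal.ofReal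
    (Real.exp (-(M * (min (infDist x Sᶜ) ρ * √(min (infDist x Sᶜ) ρ * ρ)))))
  have hsec : ∀ i : Fin (m + 1), (Measure.pi fun _ : Fin (m + 1) => P) (touchEv ρ (m + 1) i) ≤
      ∫⁻ x, G x ∂P := by
    intro i
    refine ev_bound P ρ m i G S hPS fun x hx => ?_
    refine (section_bound S hcl hne α hα hrollS hrollSc P δ hδ hlow ρ hr hrn m i x hx).trans ?_
    rw [ENNReal.ofReal_mul (by norm_num)]
    refine mul_le_mul_right (ENNReal.ofReal_le_ofReal (Real.exp_le_exp.2 (neg_le_neg ?_))) _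
    have ht0 : 0 ≤ min (infDist x Sᶜ) ρ := le_min infDist_nonneg hr.le
    have hg : 0 ≤ min (infDist x Sᶜ) ρ * √(min (infDist x Sᶜ) ρ * ρ) := by positivity
    generalize min (infDist x Sᶜ) ρ * √(min (infDist x Sᶜ) ρ * ρ) = g at *
    have hMm : M ≤ m * (δ / 48) := by
      rw [hM, hκ]; push_cast
      push_cast at hn2'
      nlinarith
    calc M * g ≤ m * (δ / 48) * g := by gcongr
      _ = _ := by ring
  have hintG : ∫⁻ x, G x ∂P ≤ ENNReal.ofReal (4 * β * (Real.exp (-(M * ρ ^ 2)) * V + B * h)) := by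
    calc ∫⁻ x, G x ∂P ≤ ∫⁻ x, G x ∂(ENNReal.ofReal β • (volume : Measure E2).restrict S) :=
          lintegral_mono' hPle le_rfl
      _ = ENNReal.ofReal β * (ENNReal.ofReal 4 * ∫⁻ x in S, ENNReal.ofReal
          (Real.exp (-(M * (min (infDist x Sᶜ) ρ * √(min (infDist x Sᶜ) ρ * ρ)))))) := by
          rw [lintegral_smul_measure, lintegral_const_mul' _ _ (by simp), smul_eq_mul]
      _ ≤ ENNReal.ofReal β * (ENNReal.ofReal 4 * ENNReal.ofReal (Real.exp (-(M * ρ ^ 2)) * V +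
          16 * V / α * tailConst * h)) := by
          gcongr
          exact tail_int S hSm (16 * V / α) (by positivity)
            (fun t ht => aux_tube S hScomp hne α hα hrollS hrollSc t ht) hScomp.measure_lt_top.ne
            M ρ h hM0 hr hh0 hMh
      _ = _ := by
          rw [← ENNReal.ofReal_mul (by norm_num), ← ENNReal.ofReal_mul hβ.le]
          congr 1; rw [hB]; ring
  refine (expect_le ρ hr.le (m + 1) _).trans ?_
  calc ∑ i, (Measure.pi fun _ : Fin (m + 1) => P) (touchEv ρ (m + 1) i)
      ≤ ∑ _i : Fin (m + 1), ENNReal.ofReal (4 * β * (Real.exp (-(M * ρ ^ 2)) * V + B * h)) :=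
        Finset.sum_le_sum fun i _ => (hsec i).trans hintG
    _ = ENNReal.ofReal (((m + 1 : ℕ) : ℝ) * (4 * β * (Real.exp (-(M * ρ ^ 2)) * V + B * h))) := by
        rw [Finset.sum_const, Finset.card_univ, Fintype.card_fin, nsmul_eq_mul,
          ENNReal.ofReal_mul (Nat.cast_nonneg _), ENNReal.ofReal_natCast]
    _ ≤ _ := by
        apply ENNReal.ofReal_le_ofReal
        refine (final_real ((m + 1 : ℕ) : ℝ) ρ α κ β V B h (by linarith) hr hrn hκ0 hβ hV0 hh
          hexp).trans ?_
        gcongr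
        linarith
end
end

section
/- Let S ⊂ ℝ² be a nonempty compact set such that a closed ball of radius α > 0 rolls freely in S and in the closure of the complement of S, and let P_X be a Borel probability measure with support S satisfying P_X(C) ≥ δ·μ(C ∩ S) for all Borel C ⊂ ℝ², for some δ > 0. Then there is a constant L₁ > 0 (independent of x and n; one may take L₁ = δπ/24) such that for every r with 0 < r ≤ α and for every x ∈ S with d(x, ∂S) > r/2, there exists a finite family 𝒰_{x,r} with 6 elements which is unavoidable for ℰ_{x,r} and satisfies P_X(U) ≥ L₁·r² for every U ∈ 𝒰_{x,r}. -/
open MeasureTheory Metric Set Filter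
open scoped RealInnerProductSpace symmDiff ENNReal Pointwise Real

noncomputable section

/-- A family `𝒰` of sets is unavoidable for `ℰ_{x,r} = {B(y,r) : y ∈ B(x,r)}`:
for every `y ∈ B(x,r)` some member of `𝒰` is contained in `B(y,r)`. -/
def unavoidable (𝒰 : Set (Set E2)) (x : E2) (r : ℝ) : Prop :=
  ∀ y ∈ closedBall x r, ∃ U ∈ 𝒰, U ⊆ closedBall y r

/-- Squared distance in the plane, in coordinates. -/
lemma dist_sq_E2 (a b : E2) : dist a b ^ 2 = (a 0 - b 0) ^ 2 + (a 1 - b 1) ^ 2 := by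
  rw [EuclideanSpace.dist_eq, Real.sq_sqrt (by positivity)]
  simp [Fin.sum_univ_two, Real.dist_eq, sq_abs]

/-- Centres of the six balls. -/
def ctr (x : E2) (r : ℝ) : Fin 6 → E2 :=
  ![!₂[x 0 + r / 4, x 1], !₂[x 0 - r / 4, x 1], !₂[x 0, x 1 + r / 4], !₂[x 0, x 1 - r / 4],
    x, !₂[x 0 + r / 8, x 1 + r / 8]]

lemma ctr_dist (x : E2) (r : ℝ) (hr : 0 < r) (i : Fin 6) : dist (ctr x r i) x ≤ r / 4 := by
  refine abs_le_of_sq_le_sq' ?_ (by positivity) |>.2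
  rw [dist_sq_E2]
  fin_cases i <;> simp [ctr] <;> nlinarith

lemma ctr_sep (x : E2) (r : ℝ) (hr : 0 < r) (i j : Fin 6) (h : i ≠ j) :
    r / 8 < dist (ctr x r i) (ctr x r j) := by
  refine lt_of_pow_lt_pow_left₀ 2 dist_nonneg ?_
  rw [dist_sq_E2]
  have : 0 < r ^ 2 := by positivity
  fin_cases i <;> fin_cases j <;> first | exact absurd rfl h | (simp [ctr]; nlinarith)

lemma key_ineq (a b r : ℝ) (hr : 0 < r) (h : a ^ 2 + b ^ 2 ≤ r ^ 2) (ha : 0 ≤ a)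
    (hab : b ^ 2 ≤ a ^ 2) : (a - r / 4) ^ 2 + b ^ 2 ≤ (7 * r / 8) ^ 2 := by
  rcases le_total (3 / 5 * r) a with h1 | h1
  · nlinarith
  · nlinarith [mul_nonneg ha (sub_nonneg.2 h1)]

lemma ctr_cover (x y : E2) (r : ℝ) (hr : 0 < r) (h : dist y x ≤ r) :
    ∃ i, dist (ctr x r i) y ≤ 7 * r / 8 := by
  have h2 : dist y x ^ 2 ≤ r ^ 2 := pow_le_pow_left₀ dist_nonneg h 2
  rw [dist_sq_E2] at h2
  have main : ∀ i, dist (ctr x r i) y ^ 2 ≤ (7 * r / 8) ^ 2 → 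
      ∃ i, dist (ctr x r i) y ≤ 7 * r / 8 := fun i hi =>
    ⟨i, (abs_le_of_sq_le_sq' hi (by positivity)).2⟩
  rcases le_total ((y 1 - x 1) ^ 2) ((y 0 - x 0) ^ 2) with hc | hc
  · rcases le_total 0 (y 0 - x 0) with hs | hs
    · apply main 0
      have := key_ineq _ _ r hr h2 hs hc
      rw [dist_sq_E2]; simp [ctr]; nlinarith
    · apply main 1
      have := key_ineq (x 0 - y 0) (y 1 - x 1) r hr (by nlinarith) (by linarith) (by nlinarith)
      rw [dist_sq_E2]; simp [ctr]; nlinarith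
  · rcases le_total 0 (y 1 - x 1) with hs | hs
    · apply main 2
      have := key_ineq (y 1 - x 1) (y 0 - x 0) r hr (by nlinarith) hs hc
      rw [dist_sq_E2]; simp [ctr]; nlinarith
    · apply main 3
      have := key_ineq (x 1 - y 1) (y 0 - x 0) r hr (by nlinarith) (by linarith) (by nlinarith)
      rw [dist_sq_E2]; simp [ctr]; nlinarith

theorem statement3
    (S : Set E2) (hSne : S.Nonempty) (hScomp : IsCompact S)
    (α : ℝ) (hα : 0 < α)
    (hrollS : rollsFreely α S) (hrollSc : rollsFreely α (closure Sᶜ))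
    (P : Measure E2) [IsProbabilityMeasure P]
    (hsupp : S = {x : E2 | ∀ ε > 0, 0 < P (ball x ε)})
    (δ : ℝ) (hδ : 0 < δ)
    (hlow : ∀ C : Set E2, MeasurableSet C → ENNReal.ofReal δ * volume (C ∩ S) ≤ P C) :
    ∃ L₁ > (0 : ℝ), ∀ r : ℝ, 0 < r → r ≤ α → ∀ x ∈ S, r / 2 < infDist x (frontier S) →
      ∃ 𝒰 : Finset (Set E2), 𝒰.card = 6 ∧ unavoidable ↑𝒰 x r ∧
        ∀ U ∈ 𝒰, ENNReal.ofReal (L₁ * r ^ 2) ≤ P U := by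
  classical
  refine ⟨δ * (π / 64), by positivity, ?_⟩
  intro r hr _ x hx hd
  have hball : ball x (r / 2) ⊆ S := by
    intro z hz
    by_contra hzS
    obtain ⟨w, hw, hwS⟩ := isPreconnected_closed_iff.1 (convex_ball x (r / 2)).isPreconnected
      (closure S) (closure Sᶜ) isClosed_closure isClosed_closure
      (fun v _ => (em (v ∈ S)).imp (fun h => subset_closure h) (fun h => subset_closure h))
      ⟨x, mem_ball_self (by positivity), subset_closure hx⟩ ⟨z, hz, subset_closure hzS⟩
    rw [← frontier_eq_closure_inter_closure] at hwS
    have h1 := infDist_le_dist_of_mem (x := x) hwS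
    rw [mem_ball, dist_comm] at hw
    linarith
  have hinj : Function.Injective (fun i => closedBall (ctr x r i) (r / 8)) := by
    intro i j hij
    by_contra hne
    have h1 : ctr x r i ∈ closedBall (ctr x r j) (r / 8) := by
      have : ctr x r i ∈ closedBall (ctr x r i) (r / 8) := mem_closedBall_self (by positivity)
      simp only at hij
      rwa [hij] at this
    rw [mem_closedBall] at h1
    linarith [ctr_sep x r hr i j hne]
  refine ⟨Finset.univ.image (fun i => closedBall (ctr x r i) (r / 8)), ?_, ?_, ?_⟩
  · rw [Finset.card_image_of_injective _ hinj]; simp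
  · intro y hy
    obtain ⟨i, hi⟩ := ctr_cover x y r hr hy
    refine ⟨closedBall (ctr x r i) (r / 8), by simp, closedBall_subset_closedBall' (by linarith)⟩
  · intro U hU
    obtain ⟨i, -, rfl⟩ := Finset.mem_image.1 hU
    refine le_trans (le_of_eq ?_) (hlow _ measurableSet_closedBall)
    have hsub : closedBall (ctr x r i) (r / 8) ⊆ S := by
      refine subset_trans (closedBall_subset_ball' ?_) hball
      linarith [ctr_dist x r hr i]
    rw [inter_eq_left.2 hsub, EuclideanSpace.volume_closedBall_fin_two,
      ← ENNReal.ofReal_pow (by positivity),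
      ← ENNReal.ofReal_mul (by positivity), ← ENNReal.ofReal_mul (by positivity)]
    congr 1; ring
end
end

section
/- Let S ⊂ ℝ² be a nonempty compact set such that a closed ball of radius α > 0 rolls freely in S and in the closure of the complement of S, and let P_X be a Borel probability measure with support S satisfying P_X(C) ≥ δ·μ(C ∩ S) for all Borel C ⊂ ℝ², for some δ > 0. Then there is a constant L₂ > 0 (independent of x and n) such that for every r with 0 < r ≤ α and for every x ∈ S with d(x, ∂S) ≤ r/2, there exists a finite family 𝒰_{x,r} with 6 elements which is unavoidable for ℰ_{x,r} and satisfies P_X(U) ≥ L₂·r^{1/2}·d(x,∂S)^{3/2} for every U ∈ 𝒰_{x,r}. -/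
open MeasureTheory Metric Set Filter
open scoped RealInnerProductSpace symmDiff ENNReal Pointwise Real

noncomputable section

lemma pad_family (𝒮 : Set (Set E2)) (h𝒮 : 𝒮.Infinite) (F : Finset (Set E2)) (hF : F.card ≤ 4)
    (hFS : ∀ U ∈ F, U ∈ 𝒮) :
    ∃ 𝒰 : Finset (Set E2), 𝒰.card = 6 ∧ F ⊆ 𝒰 ∧ ∀ U ∈ 𝒰, U ∈ 𝒮 := by
  obtain ⟨s, h1, h2, h3⟩ := h𝒮.exists_superset_ncard_eq (s := (F : Set (Set E2)))
    (fun U hU => hFS U hU) F.finite_toSet (k := 6) (by rw [Set.ncard_coe_finset]; omega)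
  have hs : s.Finite := Set.finite_of_ncard_ne_zero (by omega)
  refine ⟨hs.toFinset, ?_, ?_, ?_⟩
  · rw [← Set.ncard_eq_toFinset_card s hs, h3]
  · intro U hU
    simpa using h1 hU
  · intro U hU
    exact h2 (by simpa using hU)

lemma infinite_supersets (U : Set E2) (x : E2) (r : ℝ) (hr : 0 ≤ r) (hU : U ⊆ closedBall x r) :
    {V : Set E2 | U ⊆ V}.Infinite := by
  refine Set.infinite_of_injective_forall_mem (f := fun n : ℕ => closedBall x (r + n)) ?_ ?_
  · intro m n h
    have h' : diam (closedBall x (r + m)) = diam (closedBall x (r + n)) := congrArg diam h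
    rw [diam_closedBall_eq x (by positivity),
      diam_closedBall_eq x (by positivity)] at h'
    have : (m : ℝ) = n := by linarith
    exact_mod_cast this
  · intro n
    exact hU.trans (closedBall_subset_closedBall (by
      have : (0 : ℝ) ≤ n := by positivity
      linarith))

lemma align {X m : E2} {d α : ℝ} (hd : 0 < d) (hα : 0 < α) (hX : ‖X‖ ≤ d) (hm : ‖m‖ ≤ α)
    (h : d + α ≤ ‖X + m‖) : α • X = d • m := by
  have h1 : ‖X + m‖ ^ 2 = ‖X‖ ^ 2 + 2 * ⟪X, m⟫ + ‖m‖ ^ 2 := norm_add_sq_real X m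
  have h2 : ‖α • X - d • m‖ ^ 2 = α ^ 2 * ‖X‖ ^ 2 - 2 * (α * d * ⟪X, m⟫) + d ^ 2 * ‖m‖ ^ 2 := by
    rw [norm_sub_sq_real, norm_smul, norm_smul, inner_smul_left, inner_smul_right,
      Real.norm_of_nonneg hα.le, Real.norm_of_nonneg hd.le]
    simp
    ring
  have hX2 : ‖X‖ ^ 2 ≤ d ^ 2 := by gcongr
  have hm2 : ‖m‖ ^ 2 ≤ α ^ 2 := by gcongr
  have h3 : (d + α) ^ 2 ≤ ‖X + m‖ ^ 2 := by gcongr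
  have hi : d * α ≤ ⟪X, m⟫ := by nlinarith
  have h4 : ‖α • X - d • m‖ ^ 2 ≤ 0 := by
    rw [h2]
    have e1 := mul_le_mul_of_nonneg_left hX2 (sq_nonneg α)
    have e2 := mul_le_mul_of_nonneg_left hm2 (sq_nonneg d)
    have e3 := mul_le_mul_of_nonneg_left hi (mul_pos hα hd).le
    nlinarith
  have h5 : ‖α • X - d • m‖ = 0 := by
    have := norm_nonneg (α • X - d • m)
    nlinarith
  exact sub_eq_zero.mp (norm_eq_zero.mp h5)

/-- There is a unit direction `u` with `B(x + (α-d)u, α) ⊆ S`. -/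
lemma inner_ball (S : Set E2) (hScomp : IsCompact S) (α : ℝ) (hα : 0 < α)
    (hrollS : rollsFreely α S) (hrollSc : rollsFreely α (closure Sᶜ))
    (x : E2) (hx : x ∈ S) (hd : 0 < infDist x (frontier S)) :
    ∃ u : E2, ‖u‖ = 1 ∧ closedBall (x + (α - infDist x (frontier S)) • u) α ⊆ S := by
  set d := infDist x (frontier S) with hdd
  have hne : (frontier S).Nonempty := by
    by_contra h
    rw [Set.not_nonempty_iff_eq_empty] at h
    rw [h, infDist_empty] at hdd
    linarith
  have hfc : IsCompact (frontier S) :=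
    hScomp.of_isClosed_subset isClosed_frontier hScomp.isClosed.frontier_subset
  obtain ⟨a, ha, hxa⟩ := hfc.exists_infDist_eq_dist hne x
  obtain ⟨c, hac, hc⟩ := hrollS a ha
  have hcint : ball c α ⊆ interior S :=
    interior_maximal (ball_subset_closedBall.trans hc) isOpen_ball
  have ha' : a ∈ frontier (closure Sᶜ) := by
    rw [frontier_eq_closure_inter_closure, closure_closure]
    refine ⟨?_, ?_⟩
    · rw [frontier_eq_closure_inter_closure] at ha
      exact ha.2
    · rw [show (closure Sᶜ)ᶜ = interior S by rw [closure_compl, compl_compl]]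
      have : a ∈ closure (ball c α) := by rwa [closure_ball c hα.ne']
      exact closure_mono hcint this
  obtain ⟨c', hac', hc'⟩ := hrollSc a ha'
  have hdisj : Disjoint (interior S) (closedBall c' α) := by
    rw [Set.disjoint_left]
    intro z hz hz'
    have := hc' hz'
    rw [closure_compl] at this
    exact this hz
  have hxint : ball x d ⊆ interior S := by
    have hnf : ∀ z ∈ ball x d, z ∉ frontier S := by
      intro z hz hzf
      have := infDist_le_dist_of_mem (x := x) hzf
      rw [mem_ball, dist_comm] at hz
      linarith
    have hin : ∀ z ∈ ball x d, z ∈ S → z ∈ interior S := by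
      intro z hz hzS
      by_contra h
      exact hnf z hz ⟨subset_closure hzS, h⟩
    refine (convex_ball x d).isPreconnected.subset_of_closure_inter_subset isOpen_interior
      ⟨x, mem_ball_self hd, hin x (mem_ball_self hd) hx⟩ ?_
    rintro z ⟨hz, hzb⟩
    refine hin z hzb ?_
    have := closure_mono (interior_subset (s := S)) hz
    rwa [hScomp.isClosed.closure_eq] at this
  have k1 : d + α ≤ dist x c' :=
    (disjoint_ball_closedBall_iff hd hα.le).1 (hdisj.mono_left hxint)
  have k2 : α + α ≤ dist c c' :=
    (disjoint_ball_closedBall_iff hα hα.le).1 (hdisj.mono_left hcint)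
  rw [mem_closedBall, dist_eq_norm] at hac hac'
  rw [dist_eq_norm] at k1 k2 hxa
  have e1 := align (X := x - a) (m := a - c') hd hα hxa.ge hac' (by simpa using k1)
  have e2 := align (X := c - a) (m := a - c') hα hα (by rwa [norm_sub_rev]) hac'
    (by simpa using k2)
  have e3 : c - a = a - c' := smul_right_injective E2 hα.ne' e2
  rw [← e3] at e1
  have n1 : ‖c - a‖ = α := by
    have := congrArg norm e1
    rw [norm_smul, norm_smul, Real.norm_of_nonneg hα.le, Real.norm_of_nonneg hd.le, ← hxa] at this
    have h' : d * (‖c - a‖ - α) = 0 := by linarith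
    rcases mul_eq_zero.1 h' with h' | h'
    · linarith
    · linarith
  refine ⟨α⁻¹ • (c - a), ?_, ?_⟩
  · rw [norm_smul, n1, norm_inv, Real.norm_of_nonneg hα.le, inv_mul_cancel₀ hα.ne']
  · have : x + (α - d) • α⁻¹ • (c - a) = c := by
      have e4 : x - a = α⁻¹ • d • (c - a) := by
        rw [← e1, smul_smul, inv_mul_cancel₀ hα.ne', one_smul]
      have e5 : (α - d) • α⁻¹ • (c - a) = (c - a) - α⁻¹ • d • (c - a) := by
        rw [smul_smul, smul_smul, sub_mul, mul_inv_cancel₀ hα.ne', sub_smul, one_smul, mul_comm d]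
      rw [e5, ← e4]
      abel
    rw [this]
    exact hc

def rect (b : OrthonormalBasis (Fin 2) ℝ E2) (x : E2) (A B : Fin 2 → ℝ) : Set E2 :=
  {p | (b.repr (p - x)).ofLp ∈ Icc A B}

lemma rect_measurePreserving (b : OrthonormalBasis (Fin 2) ℝ E2) (x : E2) :
    MeasurePreserving (fun p : E2 => (b.repr (p - x)).ofLp) volume volume :=
  (PiLp.volume_preserving_ofLp (Fin 2)).comp
    ((b.measurePreserving_repr).comp (measurePreserving_sub_right volume x))

lemma rect_measurable (b : OrthonormalBasis (Fin 2) ℝ E2) (x : E2) (A B : Fin 2 → ℝ) :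
    MeasurableSet (rect b x A B) :=
  (rect_measurePreserving b x).measurable measurableSet_Icc

lemma rect_volume (b : OrthonormalBasis (Fin 2) ℝ E2) (x : E2) (A B : Fin 2 → ℝ) :
    volume (rect b x A B) = ENNReal.ofReal (B 0 - A 0) * ENNReal.ofReal (B 1 - A 1) := by
  have := (rect_measurePreserving b x).measure_preimage
    (s := Icc A B) measurableSet_Icc.nullMeasurableSet
  rw [Real.volume_Icc_pi, Fin.prod_univ_two] at this
  exact this

lemma dist_coord (b : OrthonormalBasis (Fin 2) ℝ E2) (x p y : E2) :
    dist p y ^ 2 = ((b.repr (p - x)) 0 - (b.repr (y - x)) 0) ^ 2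
      + ((b.repr (p - x)) 1 - (b.repr (y - x)) 1) ^ 2 := by
  have h : p - y = (p - x) - (y - x) := by abel
  rw [dist_eq_norm, ← b.repr.norm_map, EuclideanSpace.norm_sq_eq, Fin.sum_univ_two, h, map_sub]
  simp

lemma mem_rect (b : OrthonormalBasis (Fin 2) ℝ E2) (x p : E2) (A B : Fin 2 → ℝ) :
    p ∈ rect b x A B ↔ (A 0 ≤ (b.repr (p - x)) 0 ∧ A 1 ≤ (b.repr (p - x)) 1) ∧
      ((b.repr (p - x)) 0 ≤ B 0 ∧ (b.repr (p - x)) 1 ≤ B 1) := by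
  simp [rect, Pi.le_def, Fin.forall_fin_two]

/-- Core inequality. -/
lemma core (r d q t s Y1 Y2 : ℝ) (hr : 0 < r) (hd : 0 < d) (hdr : d ≤ r / 2) (hq : 0 < q)
    (hqq : q ^ 2 = r * d) (ht1 : q / 4 ≤ t) (ht2 : t ≤ q / 2) (hs1 : d / 4 ≤ s) (hs2 : s ≤ d / 2)
    (h1 : 0 ≤ Y1) (h2 : 0 ≤ Y2) (hY : Y1 ^ 2 + Y2 ^ 2 ≤ r ^ 2) :
    (t - Y1) ^ 2 + (s - Y2) ^ 2 ≤ r ^ 2 := by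
  have hqr : q ≤ r := by nlinarith
  obtain ⟨ρ, hρ0, hρ⟩ : ∃ ρ : ℝ, 0 ≤ ρ ∧ ρ ^ 2 = Y1 ^ 2 + Y2 ^ 2 :=
    ⟨√(Y1 ^ 2 + Y2 ^ 2), Real.sqrt_nonneg _, Real.sq_sqrt (by positivity)⟩
  have hρr : ρ ≤ r := by nlinarith
  have hρY : ρ ≤ Y1 + Y2 := by nlinarith [mul_nonneg h1 h2]
  have ht4 : t ^ 2 ≤ r * d / 4 := by nlinarith
  have hs4 : s ^ 2 ≤ r * d / 8 := by nlinarith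
  have hdq : d ≤ q := by nlinarith
  -- m = t^2+s^2 ≤ 2 r s, 2 r t
  obtain ⟨n, hn⟩ : ∃ n, n = d / 2 := ⟨_, rfl⟩
  have hm : t ^ 2 + s ^ 2 ≤ r * n := by rw [hn]; nlinarith [mul_pos hr hd]
  have ha : n * Y1 ≤ 2 * (t * Y1) := by
    have : n ≤ 2 * t := by linarith
    nlinarith
  have hb : n * Y2 ≤ 2 * (s * Y2) := by
    have : n ≤ 2 * s := by linarith
    nlinarith
  have hc : n * ρ ≤ n * (Y1 + Y2) := by
    apply mul_le_mul_of_nonneg_left hρY; linarith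
  have hfin : r * n + ρ ^ 2 - n * ρ ≤ r ^ 2 := by
    have : 0 ≤ (r - ρ) * (r + ρ - n) := by
      apply mul_nonneg <;> linarith
    nlinarith
  nlinarith

lemma core2 (α r d q t s : ℝ) (hr : 0 < r) (hrα : r ≤ α) (hd : 0 < d) (hdr : d ≤ r / 2)
    (hqq : q ^ 2 = r * d) (ht1 : -(q / 2) ≤ t) (ht2 : t ≤ q / 2) (hs1 : -(d / 2) ≤ s)
    (hs2 : s ≤ d / 2) :
    (t - 0) ^ 2 + (s - (α - d)) ^ 2 ≤ α ^ 2 := by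
  have h1 : t ^ 2 ≤ α * d / 4 := by nlinarith
  have h2 : (s - (α - d)) ^ 2 ≤ (α - d / 2) ^ 2 := by nlinarith
  have h3 : d * d ≤ α * d := by nlinarith
  nlinarith

theorem statement4
    (S : Set E2) (hSne : S.Nonempty) (hScomp : IsCompact S)
    (α : ℝ) (hα : 0 < α)
    (hrollS : rollsFreely α S) (hrollSc : rollsFreely α (closure Sᶜ))
    (P : Measure E2) [IsProbabilityMeasure P]
    (hsupp : S = {x : E2 | ∀ ε > 0, 0 < P (ball x ε)})
    (δ : ℝ) (hδ : 0 < δ)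
    (hlow : ∀ C : Set E2, MeasurableSet C → ENNReal.ofReal δ * volume (C ∩ S) ≤ P C) :
    ∃ L₂ > (0 : ℝ), ∀ r : ℝ, 0 < r → r ≤ α → ∀ x ∈ S, infDist x (frontier S) ≤ r / 2 →
      ∃ 𝒰 : Finset (Set E2), 𝒰.card = 6 ∧ unavoidable ↑𝒰 x r ∧
        ∀ U ∈ 𝒰,
          ENNReal.ofReal (L₂ * r ^ ((1 : ℝ) / 2) * (infDist x (frontier S)) ^ ((3 : ℝ) / 2))
            ≤ P U := by
  refine ⟨δ / 16, by positivity, ?_⟩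
  intro r hr hrα x hx hdr
  have hd0 : 0 ≤ infDist x (frontier S) := infDist_nonneg
  rcases hd0.eq_or_lt with h0 | hd
  · -- degenerate case
    obtain ⟨𝒰, c1, c2, -⟩ := pad_family {V : Set E2 | ∅ ⊆ V}
      (infinite_supersets ∅ x r hr.le (Set.empty_subset _)) {∅} (by simp) (by simp)
    refine ⟨𝒰, c1, ?_, ?_⟩
    · intro y _
      exact ⟨∅, c2 (by simp), Set.empty_subset _⟩
    · intro U _
      rw [← h0, Real.zero_rpow (by norm_num)]
      simp
  obtain ⟨u, hu, hball⟩ := inner_ball S hScomp α hα hrollS hrollSc x hx hd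
  set d := infDist x (frontier S) with hdd
  set b0 : ENNReal := ENNReal.ofReal (δ / 16 * r ^ ((1 : ℝ) / 2) * d ^ ((3 : ℝ) / 2)) with hb0
  obtain ⟨b, hb⟩ : ∃ b : OrthonormalBasis (Fin 2) ℝ E2, b 1 = u := by
    obtain ⟨b, hb⟩ := Orthonormal.exists_orthonormalBasis_extension_of_card_eq (𝕜 := ℝ) (E := E2)
      (ι := Fin 2) (by simp) (v := fun _ => u) (s := {1}) (by
        constructor
        · intro i
          simpa using hu
        · intro i j hij
          exact absurd (Subsingleton.elim i j) hij)
    exact ⟨b, hb 1 rfl⟩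
  obtain ⟨q, hq, hqq, hqr⟩ : ∃ q : ℝ, 0 < q ∧ q ^ 2 = r * d ∧
      q * d = r ^ ((1 : ℝ) / 2) * d ^ ((3 : ℝ) / 2) := by
    refine ⟨√(r * d), Real.sqrt_pos.2 (by positivity), Real.sq_sqrt (by positivity), ?_⟩
    rw [Real.sqrt_mul hr.le, Real.sqrt_eq_rpow, Real.sqrt_eq_rpow,
      show (3 : ℝ) / 2 = 1 / 2 + 1 by norm_num, Real.rpow_add hd, Real.rpow_one]
    ring
  have hrS : ∀ A B : Fin 2 → ℝ, -(q / 2) ≤ A 0 → B 0 ≤ q / 2 → -(d / 2) ≤ A 1 → B 1 ≤ d / 2 →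
      rect b x A B ⊆ S := by
    intro A B h1 h2 h3 h4 p hp
    apply hball
    rw [mem_rect] at hp
    rw [mem_closedBall]
    refine abs_le_of_sq_le_sq' ?_ hα.le |>.2
    rw [dist_coord b x]
    have hv : b.repr (x + (α - d) • u - x) = (α - d) • EuclideanSpace.single 1 (1 : ℝ) := by
      rw [add_sub_cancel_left, ← hb, map_smul, b.repr_self]
    rw [hv]
    have := core2 α r d q (b.repr (p - x) 0) (b.repr (p - x) 1) hr hrα hd hdr hqq
      (by linarith) (by linarith) (by linarith) (by linarith)
    simpa using this
  have hPr : ∀ A B : Fin 2 → ℝ, -(q / 2) ≤ A 0 → B 0 ≤ q / 2 → -(d / 2) ≤ A 1 → B 1 ≤ d / 2 →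
      B 0 - A 0 = q / 4 → B 1 - A 1 = d / 4 → b0 ≤ P (rect b x A B) := by
    intro A B h1 h2 h3 h4 h5 h6
    refine le_trans (le_of_eq ?_) (hlow _ (rect_measurable b x A B))
    rw [Set.inter_eq_left.2 (hrS A B h1 h2 h3 h4), rect_volume, h5, h6,
      ← ENNReal.ofReal_mul (by positivity), ← ENNReal.ofReal_mul hδ.le, hb0, mul_assoc, ← hqr]
    congr 1
    ring
  -- the four rectangles
  let R1 := rect b x ![q / 4, d / 4] ![q / 2, d / 2]
  let R2 := rect b x ![q / 4, -(d / 2)] ![q / 2, -(d / 4)]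
  let R3 := rect b x ![-(q / 2), d / 4] ![-(q / 4), d / 2]
  let R4 := rect b x ![-(q / 2), -(d / 2)] ![-(q / 4), -(d / 4)]
  have P1 : b0 ≤ P R1 := by apply hPr <;> simp <;> linarith
  have P2 : b0 ≤ P R2 := by apply hPr <;> simp <;> linarith
  have P3 : b0 ≤ P R3 := by apply hPr <;> simp <;> linarith
  have P4 : b0 ≤ P R4 := by apply hPr <;> simp <;> linarith
  have key : ∀ y ∈ closedBall x r, R1 ⊆ closedBall y r ∨ R2 ⊆ closedBall y r ∨
      R3 ⊆ closedBall y r ∨ R4 ⊆ closedBall y r := by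
    intro y hy
    have hy2 : (b.repr (y - x) 0) ^ 2 + (b.repr (y - x) 1) ^ 2 ≤ r ^ 2 := by
      have h1 := dist_coord b x y x
      have h2 : dist y x ^ 2 ≤ r ^ 2 := by
        have := mem_closedBall.1 hy
        gcongr
      simp only [sub_self, map_zero, PiLp.zero_apply, sub_zero] at h1
      linarith
    have red : ∀ p, ((b.repr (p - x)) 0 - (b.repr (y - x)) 0) ^ 2
      + ((b.repr (p - x)) 1 - (b.repr (y - x)) 1) ^ 2 ≤ r ^ 2 → p ∈ closedBall y r := by
      intro p hp
      rw [← dist_coord] at hp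
      exact (abs_le_of_sq_le_sq' hp hr.le).2
    rcases le_total 0 (b.repr (y - x) 0) with s0 | s0 <;>
      rcases le_total 0 (b.repr (y - x) 1) with s1 | s1
    · left
      intro p hp
      have hp := (mem_rect _ _ _ _ _).1 hp
      simp only [Matrix.cons_val_zero, Matrix.cons_val_one] at hp
      apply red
      exact core r d q _ _ _ _ hr hd hdr hq hqq hp.1.1 hp.2.1 hp.1.2 hp.2.2 s0 s1 hy2
    · right; left
      intro p hp
      have hp := (mem_rect _ _ _ _ _).1 hp
      simp only [Matrix.cons_val_zero, Matrix.cons_val_one] at hp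
      apply red
      have := core r d q (b.repr (p - x) 0) (-b.repr (p - x) 1) (b.repr (y - x) 0)
        (-b.repr (y - x) 1) hr hd hdr hq hqq (by linarith) (by linarith) (by linarith)
        (by linarith) (by linarith) (by linarith) (by linarith)
      linarith
    · right; right; left
      intro p hp
      have hp := (mem_rect _ _ _ _ _).1 hp
      simp only [Matrix.cons_val_zero, Matrix.cons_val_one] at hp
      apply red
      have := core r d q (-b.repr (p - x) 0) (b.repr (p - x) 1) (-b.repr (y - x) 0)
        (b.repr (y - x) 1) hr hd hdr hq hqq (by linarith) (by linarith) (by linarith)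
        (by linarith) (by linarith) (by linarith) (by linarith)
      linarith
    · right; right; right
      intro p hp
      have hp := (mem_rect _ _ _ _ _).1 hp
      simp only [Matrix.cons_val_zero, Matrix.cons_val_one] at hp
      apply red
      have := core r d q (-b.repr (p - x) 0) (-b.repr (p - x) 1) (-b.repr (y - x) 0)
        (-b.repr (y - x) 1) hr hd hdr hq hqq (by linarith) (by linarith) (by linarith)
        (by linarith) (by linarith) (by linarith) (by linarith)
      linarith
  have hinf : {V : Set E2 | b0 ≤ P V}.Infinite := by
    rcases key x (mem_closedBall_self hr.le) with h | h | h | h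
    · exact (infinite_supersets _ x r hr.le h).mono fun V hV => P1.trans (measure_mono hV)
    · exact (infinite_supersets _ x r hr.le h).mono fun V hV => P2.trans (measure_mono hV)
    · exact (infinite_supersets _ x r hr.le h).mono fun V hV => P3.trans (measure_mono hV)
    · exact (infinite_supersets _ x r hr.le h).mono fun V hV => P4.trans (measure_mono hV)
  classical
  obtain ⟨𝒰, c1, c2, c3⟩ := pad_family {V : Set E2 | b0 ≤ P V} hinf {R1, R2, R3, R4}
    Finset.card_le_four (by
      intro U hU
      simp only [Finset.mem_insert, Finset.mem_singleton] at hU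
      rcases hU with rfl | rfl | rfl | rfl
      exacts [P1, P2, P3, P4])
  refine ⟨𝒰, c1, ?_, c3⟩
  intro y hy
  rcases key y hy with h | h | h | h
  · exact ⟨R1, c2 (by simp), h⟩
  · exact ⟨R2, c2 (by simp), h⟩
  · exact ⟨R3, c2 (by simp), h⟩
  · exact ⟨R4, c2 (by simp), h⟩
end
end
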